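/- arXiv:2305.05272 — 2 statements merged into one kernel-verified Lean document; each statement's English description precedes it below -/
import Mathlib

section
/- Let m ≥ 3 be an integer, let 1 < q < p < ∞, and let α, β ∈ ℝ satisfy α + β > 0, α + 1/p ≥ −3, β − 1/q ≥ −2, and 1/q = 1/p + (α+β)/3. Define, for r, r̄ > 0 and z, z̄ ∈ ℝ, H̃_m(r,r̄,z,z̄) := r^{α+1/p−1/2} r̄^{β−1/q−3/2} |F_m(ξ²)| and H_m(r,r̄,z,z̄) := r^{α+1/p−1/2} r̄^{β−1/q−3/2}(|F_m(ξ²)| + |F_m'(ξ²)| ((|r−r̄| + |z−z̄|)/r + ξ²)), where ξ² := ((r−r̄)² + (z−z̄)²)/(r r̄). Then for every sufficiently small ε > 0 there is a constant C_ε, independent of m, such that for all r, r̄ > 0 and z, z̄ ∈ ℝ: H̃_m(r,r̄,z,z̄) ≤ C_ε m^{−(1+1/p−1/q−ε)} ((r−r̄)² + (z−z̄)²)^{−(1+1/p−1/q)}; and if in addition 1/2 + 1/p − 1/q > 0, then H_m(r,r̄,z,z̄) ≤ C_ε m^{−(1/2+1/p−1/q−ε)} ((r−r̄)² + (z−z̄)²)^{−(1+1/p−1/q)}.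 -/
open Real MeasureTheory Set

noncomputable section

/-- `F_m(s) = ∫₀^π cos(mθ)/√(s + 2(1 − cos θ)) dθ`. -/
def Fm (m : ℕ) (s : ℝ) : ℝ :=
  ∫ θ in (0:ℝ)..Real.pi, Real.cos (m * θ) / Real.sqrt (s + 2 * (1 - Real.cos θ))

/-- `F_m'(s) = −(1/2)∫₀^π cos(mθ)(s + 2(1 − cos θ))^{−3/2} dθ`. -/
def Fm' (m : ℕ) (s : ℝ) : ℝ :=
  -(1/2) * ∫ θ in (0:ℝ)..Real.pi, Real.cos (m * θ) * (s + 2 * (1 - Real.cos θ)) ^ (-(3:ℝ)/2)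

/-- `ξ² = ((r − r̄)² + (z − z̄)²)/(r r̄)`. -/
def xiSq (r r' z z' : ℝ) : ℝ := ((r - r')^2 + (z - z')^2) / (r * r')

/-- The kernel `H̃_m`. -/
def Htilde (m : ℕ) (p q α β r r' z z' : ℝ) : ℝ :=
  r ^ (α + 1/p - 1/2) * r' ^ (β - 1/q - 3/2) * |Fm m (xiSq r r' z z')|

/-- The kernel `H_m`. -/
def Hker (m : ℕ) (p q α β r r' z z' : ℝ) : ℝ :=
  r ^ (α + 1/p - 1/2) * r' ^ (β - 1/q - 3/2) *
    (|Fm m (xiSq r r' z z')| +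
      |Fm' m (xiSq r r' z z')| * ((|r - r'| + |z - z'|)/r + xiSq r r' z z'))

/-- The cosine coefficient `∫₀^π cos(nθ) (s + 2(1 − cos θ))^{−k} dθ`. -/
def cosCoeff (k : ℝ) (n : ℕ) (s : ℝ) : ℝ :=
  ∫ θ in (0:ℝ)..Real.pi, Real.cos (n * θ) * (s + 2 * (1 - Real.cos θ)) ^ (-k)

lemma base_ge (s θ : ℝ) : s ≤ s + 2 * (1 - Real.cos θ) := by
  linarith [Real.cos_le_one θ]

lemma continuous_base_rpow {s : ℝ} (hs : 0 < s) (k : ℝ) :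
    Continuous fun θ : ℝ => (s + 2 * (1 - Real.cos θ)) ^ k :=
  Continuous.rpow_const (by fun_prop) fun θ => Or.inl (hs.trans_le (base_ge s θ)).ne'

lemma hasDerivAt_base_rpow {s : ℝ} (hs : 0 < s) (k θ : ℝ) :
    HasDerivAt (fun θ : ℝ => (s + 2 * (1 - Real.cos θ)) ^ (-k))
      (-(2 * k) * (Real.sin θ * (s + 2 * (1 - Real.cos θ)) ^ (-(k + 1)))) θ := by
  have h : HasDerivAt (fun θ : ℝ => s + 2 * (1 - Real.cos θ)) (2 * Real.sin θ) θ := by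
    simpa using (((Real.hasDerivAt_cos θ).const_sub 1).const_mul 2).const_add s
  convert h.rpow_const (p := -k) (Or.inl (hs.trans_le (base_ge s θ)).ne') using 1
  rw [show -(k + 1) = -k - 1 by ring]
  ring

lemma abs_cosCoeff_le {s : ℝ} (hs : 0 < s) {k : ℝ} (hk : 0 ≤ k) (n : ℕ) :
    |cosCoeff k n s| ≤ Real.pi * s ^ (-k) := by
  have h := intervalIntegral.norm_integral_le_of_norm_le_const (a := 0) (b := Real.pi)
    (f := fun θ => Real.cos (n * θ) * (s + 2 * (1 - Real.cos θ)) ^ (-k)) (C := s ^ (-k)) ?_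
  · rw [sub_zero, abs_of_pos Real.pi_pos, mul_comm] at h
    exact h
  · intro θ _
    have hb := base_ge s θ
    rw [norm_mul, Real.norm_eq_abs, Real.norm_eq_abs,
      abs_of_nonneg (Real.rpow_nonneg (hs.le.trans hb) _)]
    calc _ ≤ 1 * s ^ (-k) := mul_le_mul (Real.abs_cos_le_one _)
          (Real.rpow_le_rpow_of_nonpos hs hb (by linarith))
          (Real.rpow_nonneg (hs.le.trans hb) _) zero_le_one
      _ = _ := one_mul _

/-- Integration by parts. -/
lemma mul_cosCoeff {s : ℝ} (hs : 0 < s) (k : ℝ) (n : ℕ) :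
    n * cosCoeff k n s = 2 * k * ∫ θ in (0:ℝ)..Real.pi,
      Real.sin (n * θ) * (Real.sin θ * (s + 2 * (1 - Real.cos θ)) ^ (-(k + 1))) := by
  have c1 := continuous_base_rpow hs (-k)
  have c2 := continuous_base_rpow hs (-(k + 1))
  have hd : ∀ θ ∈ uIcc (0:ℝ) Real.pi, HasDerivAt
      (fun θ : ℝ => Real.sin (n * θ) * (s + 2 * (1 - Real.cos θ)) ^ (-k))
      (n * (Real.cos (n * θ) * (s + 2 * (1 - Real.cos θ)) ^ (-k)) -
        2 * k * (Real.sin (n * θ) *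
          (Real.sin θ * (s + 2 * (1 - Real.cos θ)) ^ (-(k + 1))))) θ := by
    intro θ _
    have h : HasDerivAt (fun θ : ℝ => Real.sin (n * θ)) (Real.cos (n * θ) * n) θ := by
      simpa using ((hasDerivAt_id θ).const_mul (n : ℝ)).sin
    refine (h.fun_mul (hasDerivAt_base_rpow hs k θ)).congr_deriv ?_
    ring
  have h := intervalIntegral.integral_eq_sub_of_hasDerivAt hd
    (Continuous.intervalIntegrable (by fun_prop) _ _)
  rw [intervalIntegral.integral_sub (Continuous.intervalIntegrable (by fun_prop) _ _)
    (Continuous.intervalIntegrable (by fun_prop) _ _), intervalIntegral.integral_const_mul,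
    intervalIntegral.integral_const_mul] at h
  simp only [Real.sin_nat_mul_pi, mul_zero, Real.sin_zero, zero_mul, sub_zero] at h
  exact sub_eq_zero.mp h

lemma cosCoeff_recurrence {s : ℝ} (hs : 0 < s) (k : ℝ) (n : ℕ) :
    ((n + 1 : ℕ) : ℝ) * cosCoeff k (n + 1) s =
      k * (cosCoeff (k + 1) n s - cosCoeff (k + 1) (n + 2) s) := by
  have c2 := continuous_base_rpow hs (-(k + 1))
  rw [mul_cosCoeff hs, cosCoeff, cosCoeff, ← intervalIntegral.integral_sub
    (Continuous.intervalIntegrable (by fun_prop) _ _)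
    (Continuous.intervalIntegrable (by fun_prop) _ _), mul_comm 2 k, mul_assoc,
    ← intervalIntegral.integral_const_mul]
  congr 1
  refine intervalIntegral.integral_congr fun θ _ => ?_
  have h1 : ((n : ℕ) : ℝ) * θ = (n + 1 : ℕ) * θ - θ := by push_cast; ring
  have h2 : ((n + 2 : ℕ) : ℝ) * θ = (n + 1 : ℕ) * θ + θ := by push_cast; ring
  simp only [h1, h2, Real.cos_sub, Real.cos_add]
  ring

lemma mul_abs_cosCoeff_le {s : ℝ} (hs : 0 < s) {k : ℝ} (hk : 0 ≤ k) {n : ℕ} {M : ℝ}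
    (h₀ : |cosCoeff (k + 1) n s| ≤ M) (h₂ : |cosCoeff (k + 1) (n + 2) s| ≤ M) :
    ((n + 1 : ℕ) : ℝ) * |cosCoeff k (n + 1) s| ≤ 2 * k * M := by
  have h := congrArg abs (cosCoeff_recurrence hs k n)
  rw [abs_mul, abs_mul, Nat.abs_cast, abs_of_nonneg hk] at h
  rw [h]
  have := abs_sub (cosCoeff (k + 1) n s) (cosCoeff (k + 1) (n + 2) s)
  nlinarith

lemma abs_cosCoeff_succ_le {s : ℝ} (hs : 0 < s) {k : ℝ} (hk : 0 ≤ k) {n : ℕ} {M : ℝ}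
    (h₀ : |cosCoeff (k + 1) n s| ≤ M) (h₂ : |cosCoeff (k + 1) (n + 2) s| ≤ M) :
    |cosCoeff k (n + 1) s| ≤ 2 * k * M := by
  refine le_trans ?_ (mul_abs_cosCoeff_le hs hk h₀ h₂)
  exact le_mul_of_one_le_left (abs_nonneg _) (by push_cast; linarith [n.cast_nonneg (α := ℝ)])

/-- Decay at infinity, from three integrations by parts. -/
lemma mul_abs_cosCoeff_le_rpow {s : ℝ} (hs : 0 < s) {k : ℝ} (hk : 0 ≤ k) {m : ℕ} (hm : 3 ≤ m) :
    (m : ℝ) * |cosCoeff k m s| ≤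
      2 * k * (2 * (k + 1) * (2 * (k + 2) * Real.pi)) * s ^ (-(k + 3)) := by
  obtain ⟨n, rfl⟩ := Nat.exists_eq_add_of_le' hm
  have h1 : ∀ j : ℕ, |cosCoeff (k + 1 + 1) (j + 1) s| ≤
      2 * (k + 1 + 1) * (Real.pi * s ^ (-(k + 1 + 1 + 1))) := fun j =>
    abs_cosCoeff_succ_le hs (by linarith) (abs_cosCoeff_le hs (by linarith) _)
      (abs_cosCoeff_le hs (by linarith) _)
  have h2 : ∀ j : ℕ, |cosCoeff (k + 1) (j + 2) s| ≤ _ := fun j =>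
    abs_cosCoeff_succ_le hs (by linarith) (h1 j) (h1 (j + 2))
  refine (mul_abs_cosCoeff_le hs hk (h2 n) (h2 (n + 2))).trans_eq ?_
  rw [show k + 1 + 1 + 1 = k + 3 by ring]
  ring

lemma mul_abs_cosCoeff_le_rpow_neg {s : ℝ} (hs : 0 < s) {k : ℝ} (hk : 0 < k) (n : ℕ) :
    n * |cosCoeff k n s| ≤ s ^ (-k) := by
  have c2 := continuous_base_rpow hs (-(k + 1))
  have h := congrArg abs (mul_cosCoeff hs k n)
  rw [abs_mul, Nat.abs_cast] at h
  rw [h, ← intervalIntegral.integral_const_mul, ← Real.norm_eq_abs]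
  have hd := intervalIntegral.integral_eq_sub_of_hasDerivAt (a := 0) (b := Real.pi)
    (fun θ _ => (hasDerivAt_base_rpow hs k θ).neg)
    (Continuous.intervalIntegrable (by fun_prop) _ _)
  refine le_trans (intervalIntegral.norm_integral_le_of_norm_le (g := fun θ =>
    -(-(2 * k) * (Real.sin θ * (s + 2 * (1 - Real.cos θ)) ^ (-(k + 1))))) Real.pi_pos.le
    (ae_of_all _ fun θ hθ => ?_) (Continuous.intervalIntegrable (by fun_prop) _ _)) ?_
  · have h0 : 0 ≤ Real.sin θ * (s + 2 * (1 - Real.cos θ)) ^ (-(k + 1)) :=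
      mul_nonneg (Real.sin_nonneg_of_nonneg_of_le_pi hθ.1.le hθ.2)
        (Real.rpow_nonneg (hs.le.trans (base_ge s θ)) _)
    rw [Real.norm_eq_abs, abs_mul (2 * k), abs_mul (Real.sin _), abs_of_nonneg h0,
      abs_of_pos (by linarith : 0 < 2 * k)]
    have := mul_le_mul_of_nonneg_right (Real.abs_sin_le_one (n * θ)) h0
    nlinarith
  · rw [hd]
    have : 0 ≤ (s + 2 * (1 - Real.cos Real.pi)) ^ (-k) :=
      Real.rpow_nonneg (hs.le.trans (base_ge s _)) _
    simp only [Pi.neg_apply, Real.cos_zero, sub_self, mul_zero, add_zero]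
    linarith

lemma abs_cosCoeff_le_rpow {k l : ℝ} (hk : 1 / 2 ≤ k) (hl : 0 < l) (hl1 : l ≤ 1) :
    ∃ C : ℝ, 0 < C ∧ ∀ (n : ℕ) (s : ℝ), 0 < s →
      |cosCoeff k n s| ≤ C * s ^ (-(k - 1 / 2) - l / 2) := by
  refine ⟨(2 / Real.pi) ^ (l - 1) * (Real.pi ^ l / l), by positivity, fun n s hs => ?_⟩
  have hi : IntervalIntegrable (fun θ : ℝ => θ ^ (l - 1)) volume 0 Real.pi :=
    intervalIntegral.intervalIntegrable_rpow' (by linarith)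
  rw [cosCoeff, ← Real.norm_eq_abs]
  refine le_trans (intervalIntegral.norm_integral_le_of_norm_le (g := fun θ =>
    s ^ (-(k - 1 / 2) - l / 2) * (2 / Real.pi) ^ (l - 1) * θ ^ (l - 1)) Real.pi_pos.le
    (ae_of_all _ fun θ hθ => ?_) (hi.const_mul _)) (le_of_eq ?_)
  · have hb := base_ge s θ
    have hθ0 : 0 < θ := hθ.1
    have hu : (2 / Real.pi * θ) ^ 2 ≤ s + 2 * (1 - Real.cos θ) := by
      have := Real.cos_le_one_sub_mul_cos_sq (x := θ) (abs_le.mpr ⟨by linarith [Real.pi_pos], hθ.2⟩)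
      have e : (2 / Real.pi * θ) ^ 2 = 2 * (2 / Real.pi ^ 2 * θ ^ 2) := by ring
      rw [e]; linarith
    have hbp : 0 < s + 2 * (1 - Real.cos θ) := hs.trans_le hb
    have hp : 0 < 2 / Real.pi * θ := by positivity
    rw [norm_mul, Real.norm_eq_abs, Real.norm_eq_abs, abs_of_pos (Real.rpow_pos_of_pos hbp _),
      mul_assoc, ← Real.mul_rpow (by positivity) hθ0.le]
    have e1 : (2 / Real.pi * θ) ^ (l - 1) = ((2 / Real.pi * θ) ^ 2) ^ ((l - 1) / 2) := by
      rw [← Real.rpow_natCast, ← Real.rpow_mul hp.le]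
      congr 1
      push_cast
      ring
    rw [e1]
    calc _ ≤ 1 * (s + 2 * (1 - Real.cos θ)) ^ (-k) := by
          gcongr
          exact Real.abs_cos_le_one _
      _ = (s + 2 * (1 - Real.cos θ)) ^ (-(k - 1 / 2) - l / 2) *
          (s + 2 * (1 - Real.cos θ)) ^ ((l - 1) / 2) := by
          rw [one_mul, ← Real.rpow_add hbp]; congr 1; ring
      _ ≤ _ := mul_le_mul (Real.rpow_le_rpow_of_nonpos hs hb (by linarith))
          (Real.rpow_le_rpow_of_nonpos (by positivity) hu (by linarith)) (by positivity)
          (by positivity)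
  · rw [intervalIntegral.integral_const_mul, integral_rpow (Or.inl (by linarith)),
      sub_add_cancel, Real.zero_rpow hl.ne']
    ring

lemma le_rpow_mul_rpow {x X Y l : ℝ} (hx : 0 ≤ x) (hX : x ≤ X) (hY : x ≤ Y) (hl : 0 ≤ l)
    (hl1 : l ≤ 1) : x ≤ X ^ (1 - l) * Y ^ l := by
  calc x = x ^ (1 - l) * x ^ l := by
        rw [← Real.rpow_add_of_nonneg hx (by linarith) hl, sub_add_cancel, Real.rpow_one]
    _ ≤ _ := mul_le_mul (Real.rpow_le_rpow hx hX (by linarith)) (Real.rpow_le_rpow hx hY hl)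
        (Real.rpow_nonneg hx _) (Real.rpow_nonneg (hx.trans hX) _)

/-- The uniform bound on the cosine coefficients. -/
lemma abs_cosCoeff_le_uniform {k l : ℝ} (hk : 1 / 2 ≤ k) (hl : 0 < l) (hl1 : l ≤ 1) :
    ∃ C : ℝ, 0 < C ∧ ∀ (m : ℕ) (s : ℝ), 3 ≤ m → 0 < s →
      |cosCoeff k m s| ≤
        C * (m : ℝ) ^ (-l) * (s ^ (-(k - 1 / 2) - l) * (s + 2) ^ (l - 7 / 2)) := by
  obtain ⟨C₁, hC₁, h₁⟩ := abs_cosCoeff_le_rpow hk hl hl1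
  set C₂ := 2 * k * (2 * (k + 1) * (2 * (k + 2) * Real.pi)) with hC₂
  have hC₂p : 0 < C₂ := by positivity
  refine ⟨(C₁ ^ (1 - l) + C₂) * 3 ^ (7 / 2 - l), by positivity, fun m s hm hs => ?_⟩
  have hm1 : (1 : ℝ) ≤ m := by exact_mod_cast (by omega : 1 ≤ m)
  have hm0 : (0 : ℝ) < m := by linarith
  have key : ∀ t : ℝ, 0 < t → s + 2 ≤ 3 * t → t ^ (l - 7 / 2) ≤
      3 ^ (7 / 2 - l) * (s + 2) ^ (l - 7 / 2) := by
    intro t ht h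
    have := Real.rpow_le_rpow_of_nonpos (by linarith : 0 < s + 2) h (by linarith : l - 7 / 2 ≤ 0)
    rw [Real.mul_rpow (by norm_num) ht.le] at this
    calc t ^ (l - 7 / 2) = 3 ^ (7 / 2 - l) * (3 ^ (l - 7 / 2) * t ^ (l - 7 / 2)) := by
          rw [← mul_assoc, ← Real.rpow_add (by norm_num)]; simp
      _ ≤ _ := by gcongr
  rcases le_total s 1 with hs1 | hs1
  · have hY : |cosCoeff k m s| ≤ s ^ (-k) * (m : ℝ) ^ (-1 : ℝ) := by
      rw [Real.rpow_neg_one, ← div_eq_mul_inv, le_div_iff₀ hm0, mul_comm]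
      exact mul_abs_cosCoeff_le_rpow_neg hs (by linarith) m
    calc |cosCoeff k m s| ≤ _ := le_rpow_mul_rpow (abs_nonneg _) (h₁ m s hs) hY hl.le hl1
      _ = C₁ ^ (1 - l) * (m : ℝ) ^ (-l) * s ^ ((-(k - 1 / 2) - l / 2) * (1 - l) + -k * l) := by
          rw [Real.mul_rpow hC₁.le (by positivity), Real.mul_rpow (by positivity) (by positivity),
            ← Real.rpow_mul hs.le, ← Real.rpow_mul hs.le, ← Real.rpow_mul hm0.le,
            Real.rpow_add hs, neg_one_mul]
          ring
      _ ≤ (C₁ ^ (1 - l) + C₂) * (m : ℝ) ^ (-l) * (s ^ (-(k - 1 / 2) - l) *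
          (3 ^ (7 / 2 - l) * (s + 2) ^ (l - 7 / 2))) := by
          have hp : s ^ ((-(k - 1 / 2) - l / 2) * (1 - l) + -k * l) ≤
              s ^ (-(k - 1 / 2) - l) := by
            apply Real.rpow_le_rpow_of_exponent_ge hs hs1
            nlinarith
          have h3 := key 1 one_pos (by linarith)
          rw [Real.one_rpow] at h3
          have := mul_le_mul hp h3 zero_le_one (by positivity)
          rw [mul_one] at this
          gcongr
          linarith
      _ = _ := by ring
  · have hY : |cosCoeff k m s| ≤ C₂ * s ^ (-(k + 3)) * (m : ℝ) ^ (-1 : ℝ) := by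
      rw [Real.rpow_neg_one, ← div_eq_mul_inv, le_div_iff₀ hm0, mul_comm]
      exact mul_abs_cosCoeff_le_rpow hs (by linarith) hm
    calc |cosCoeff k m s| ≤ C₂ * s ^ (-(k + 3)) * (m : ℝ) ^ (-1 : ℝ) := hY
      _ = C₂ * (m : ℝ) ^ (-1 : ℝ) * (s ^ (-(k - 1 / 2) - l) * s ^ (l - 7 / 2)) := by
          rw [← Real.rpow_add hs, show -(k - 1 / 2) - l + (l - 7 / 2) = -(k + 3) by ring]
          ring
      _ ≤ (C₁ ^ (1 - l) + C₂) * (m : ℝ) ^ (-l) * (s ^ (-(k - 1 / 2) - l) *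
          (3 ^ (7 / 2 - l) * (s + 2) ^ (l - 7 / 2))) := by
          have h3 := key s hs (by linarith)
          have h4 : 0 < C₁ ^ (1 - l) := by positivity
          gcongr
          linarith
      _ = _ := by ring

lemma Fm_eq_cosCoeff {s : ℝ} (hs : 0 < s) (m : ℕ) : Fm m s = cosCoeff (1 / 2) m s := by
  refine intervalIntegral.integral_congr fun θ _ => ?_
  rw [Real.rpow_neg (hs.le.trans (base_ge s θ)), ← Real.sqrt_eq_rpow, div_eq_mul_inv]

lemma Fm'_eq_cosCoeff (m : ℕ) (s : ℝ) : Fm' m s = -(1 / 2) * cosCoeff (3 / 2) m s := by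
  simp only [Fm', cosCoeff, neg_div]

/-- At `s = 0` the integrand is not integrable. -/
lemma Fm_zero (m : ℕ) : Fm m 0 = 0 := by
  refine intervalIntegral.integral_undef ?_
  refine not_intervalIntegrable_of_sub_inv_isBigO_punctured (c := 0) ?_ Real.pi_pos.ne
    left_mem_uIcc
  refine Asymptotics.IsBigO.of_bound 2 ?_
  have hc : Filter.Tendsto (fun θ : ℝ => Real.cos (m * θ)) (nhds 0) (nhds 1) := by
    have : Continuous fun θ : ℝ => Real.cos (m * θ) := by fun_prop
    simpa using this.tendsto 0
  have h1 := (hc.eventually (lt_mem_nhds (by norm_num : (1 / 2 : ℝ) < 1))).filter_mono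
    (nhdsWithin_le_nhds (s := {0}ᶜ))
  have h2 := (eventually_abs_sub_lt (0 : ℝ) one_pos).filter_mono
    (nhdsWithin_le_nhds (s := {0}ᶜ))
  filter_upwards [h1, h2, self_mem_nhdsWithin] with θ hθ hθ1 hθ0
  have hθ0 : θ ≠ 0 := hθ0
  rw [sub_zero] at hθ1
  have hcos : Real.cos θ < 1 := by
    refine (Real.cos_le_one θ).lt_of_ne fun h => hθ0 ?_
    have hπ := Real.pi_gt_three
    exact (Real.cos_eq_one_iff_of_lt_of_lt (by linarith [neg_abs_le θ])
      (by linarith [le_abs_self θ])).mp h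
  have hq : Real.sqrt (0 + 2 * (1 - Real.cos θ)) ≤ |θ| := by
    apply Real.sqrt_le_iff.mpr ⟨abs_nonneg _, ?_⟩
    rw [sq_abs]
    linarith [Real.one_sub_sq_div_two_le_cos (x := θ)]
  have hq0 : 0 < Real.sqrt (0 + 2 * (1 - Real.cos θ)) := Real.sqrt_pos.mpr (by linarith)
  rw [sub_zero, norm_inv, norm_div, Real.norm_eq_abs, Real.norm_eq_abs, Real.norm_eq_abs,
    abs_of_pos hq0, abs_of_pos (by linarith : 0 < Real.cos (m * θ)), inv_eq_one_div,
    ← mul_div_assoc]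
  exact div_le_div₀ (by linarith) (by linarith) hq0 hq

lemma div_le_xiSq_add_two {r r' : ℝ} (z z' : ℝ) (hr : 0 < r) (hr' : 0 < r') :
    r / r' ≤ xiSq r r' z z' + 2 ∧ r' / r ≤ xiSq r r' z z' + 2 := by
  have h : xiSq r r' z z' + 2 = r / r' + r' / r + (z - z') ^ 2 / (r * r') := by
    unfold xiSq; field_simp; ring
  rw [h]
  constructor
  · have : 0 < r' / r := by positivity
    have : 0 ≤ (z - z') ^ 2 / (r * r') := by positivity
    linarith
  · have : 0 < r / r' := by positivity
    have : 0 ≤ (z - z') ^ 2 / (r * r') := by positivity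
    linarith

lemma rpow_le_rpow_of_inv_le {x y a b : ℝ} (hx : 0 < x) (hy : 1 ≤ y) (h : x ≤ y) (h' : x⁻¹ ≤ y)
    (hab : a ≤ b) (hab' : -a ≤ b) : x ^ a ≤ y ^ b := by
  rcases le_total 0 a with ha | ha
  · exact (Real.rpow_le_rpow hx.le h ha).trans (Real.rpow_le_rpow_of_exponent_le hy hab)
  · rw [← inv_inv x, Real.inv_rpow (by positivity), ← Real.rpow_neg (by positivity)]
    exact (Real.rpow_le_rpow (by positivity) h' (by linarith)).trans
      (Real.rpow_le_rpow_of_exponent_le hy hab')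

lemma weight_le {r r' z z' A B c : ℝ} (hr : 0 < r) (hr' : 0 < r')
    (hD : 0 < (r - r') ^ 2 + (z - z') ^ 2) (hA : -(7 / 2) ≤ A) (hB : -(7 / 2) ≤ B)
    (hAB : A + B = -2 * c) :
    r ^ A * r' ^ B ≤ (xiSq r r' z z' + 2) ^ (7 / 2 - c) * xiSq r r' z z' ^ c *
      ((r - r') ^ 2 + (z - z') ^ 2) ^ (-c) := by
  have hs : 0 < xiSq r r' z z' := by unfold xiSq; positivity
  obtain ⟨h1, h2⟩ := div_le_xiSq_add_two z z' hr hr'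
  have hw : (r / r') ^ (A + c) ≤ (xiSq r r' z z' + 2) ^ (7 / 2 - c) :=
    rpow_le_rpow_of_inv_le (by positivity) (by linarith) h1 (by rwa [inv_div])
      (by linarith) (by linarith)
  have e1 : r ^ A * r' ^ B = (r / r') ^ (A + c) * (r * r') ^ (-c) := by
    rw [Real.div_rpow hr.le hr'.le, Real.mul_rpow hr.le hr'.le, show B = -c - (A + c) by linarith,
      Real.rpow_sub hr', Real.rpow_add hr, Real.rpow_neg hr.le]
    field_simp
  have e2 : (r * r') ^ (-c) = xiSq r r' z z' ^ c *
      ((r - r') ^ 2 + (z - z') ^ 2) ^ (-c) := by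
    unfold xiSq
    rw [Real.div_rpow hD.le (by positivity), Real.rpow_neg hD.le, Real.rpow_neg (by positivity)]
    have : 0 < ((r - r') ^ 2 + (z - z') ^ 2) ^ c := by positivity
    field_simp
  rw [e1, e2, mul_assoc]
  gcongr

lemma drift_le {r r' : ℝ} (z z' : ℝ) (hr : 0 < r) (hr' : 0 < r') :
    (|r - r'| + |z - z'|) / r + xiSq r r' z z' ≤
      3 * (xiSq r r' z z' ^ (1 / 2 : ℝ) * (xiSq r r' z z' + 2) ^ (1 / 2 : ℝ)) := by
  have hs : 0 ≤ xiSq r r' z z' := by unfold xiSq; positivity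
  obtain ⟨-, h2⟩ := div_le_xiSq_add_two z z' hr hr'
  have e : xiSq r r' z z' * (r' / r) = ((r - r') ^ 2 + (z - z') ^ 2) / r ^ 2 := by
    unfold xiSq; field_simp
  have hD : ((r - r') ^ 2 + (z - z') ^ 2) / r ^ 2 ≤ xiSq r r' z z' * (xiSq r r' z z' + 2) := by
    rw [← e]; gcongr
  have hx : |r - r'| / r ≤ Real.sqrt (xiSq r r' z z' * (xiSq r r' z z' + 2)) := by
    refine Real.le_sqrt_of_sq_le (le_trans ?_ hD)
    rw [div_pow, sq_abs]
    gcongr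
    nlinarith [sq_nonneg (z - z')]
  have hz : |z - z'| / r ≤ Real.sqrt (xiSq r r' z z' * (xiSq r r' z z' + 2)) := by
    refine Real.le_sqrt_of_sq_le (le_trans ?_ hD)
    rw [div_pow, sq_abs]
    gcongr
    nlinarith [sq_nonneg (r - r')]
  have hx2 : xiSq r r' z z' ≤ Real.sqrt (xiSq r r' z z' * (xiSq r r' z z' + 2)) :=
    Real.le_sqrt_of_sq_le (by nlinarith)
  rw [← Real.mul_rpow hs (by linarith), ← Real.sqrt_eq_rpow, add_div]
  linarith

lemma weight_mul_Fm_le {A B c : ℝ} (hA : -(7 / 2) ≤ A) (hB : -(7 / 2) ≤ B)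
    (hAB : A + B = -2 * c) (hc : 0 < c) (hc1 : c ≤ 1) :
    ∃ C : ℝ, 0 < C ∧ ∀ (m : ℕ) (r r' z z' : ℝ), 3 ≤ m → 0 < r → 0 < r' →
      r ^ A * r' ^ B * |Fm m (xiSq r r' z z')| ≤
        C * (m : ℝ) ^ (-c) * ((r - r') ^ 2 + (z - z') ^ 2) ^ (-c) := by
  obtain ⟨C, hC, h⟩ := abs_cosCoeff_le_uniform (le_refl (1 / 2 : ℝ)) hc hc1
  refine ⟨C, hC, fun m r r' z z' hm hr hr' => ?_⟩
  rcases (by positivity : 0 ≤ (r - r') ^ 2 + (z - z') ^ 2).eq_or_lt with hD | hD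
  · rw [show xiSq r r' z z' = 0 by rw [xiSq, ← hD, zero_div], Fm_zero, abs_zero, mul_zero]
    positivity
  have hs : 0 < xiSq r r' z z' := by unfold xiSq; positivity
  rw [Fm_eq_cosCoeff hs]
  refine (mul_le_mul (weight_le hr hr' hD hA hB hAB) (h m _ hm hs) (abs_nonneg _)
    (by positivity)).trans_eq ?_
  have hs2 : 0 < xiSq r r' z z' + 2 := by linarith
  have e1 : xiSq r r' z z' ^ c * xiSq r r' z z' ^ (-(1 / 2 - 1 / 2) - c) = 1 := by
    rw [← Real.rpow_add hs]; norm_num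
  have e2 : (xiSq r r' z z' + 2) ^ (7 / 2 - c) * (xiSq r r' z z' + 2) ^ (c - 7 / 2) = 1 := by
    rw [← Real.rpow_add hs2]; simp
  linear_combination C * (m : ℝ) ^ (-c) * ((r - r') ^ 2 + (z - z') ^ 2) ^ (-c) *
    ((xiSq r r' z z' + 2) ^ (7 / 2 - c) * (xiSq r r' z z' + 2) ^ (c - 7 / 2) * e1 + e2)

lemma weight_mul_Fm'_le {A B c : ℝ} (hA : -(7 / 2) ≤ A) (hB : -(7 / 2) ≤ B)
    (hAB : A + B = -2 * c) (hc : 1 / 2 < c) (hc1 : c ≤ 1) :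
    ∃ C : ℝ, 0 < C ∧ ∀ (m : ℕ) (r r' z z' : ℝ), 3 ≤ m → 0 < r → 0 < r' →
      r ^ A * r' ^ B * (|Fm' m (xiSq r r' z z')| *
          ((|r - r'| + |z - z'|) / r + xiSq r r' z z')) ≤
        C * (m : ℝ) ^ (-(c - 1 / 2)) * ((r - r') ^ 2 + (z - z') ^ 2) ^ (-c) := by
  obtain ⟨C, hC, h⟩ := abs_cosCoeff_le_uniform (by norm_num : 1 / 2 ≤ (3 / 2 : ℝ))
    (by linarith : 0 < c - 1 / 2) (by linarith)
  refine ⟨3 / 2 * C, by positivity, fun m r r' z z' hm hr hr' => ?_⟩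
  rcases (by positivity : 0 ≤ (r - r') ^ 2 + (z - z') ^ 2).eq_or_lt with hD | hD
  · have h1 : r - r' = 0 := by nlinarith [sq_nonneg (r - r'), sq_nonneg (z - z')]
    have h2 : z - z' = 0 := by nlinarith [sq_nonneg (r - r'), sq_nonneg (z - z')]
    rw [show xiSq r r' z z' = 0 by rw [xiSq, ← hD, zero_div], h1, h2, abs_zero, add_zero, add_zero,
      zero_div, mul_zero, mul_zero]
    positivity
  have hs : 0 < xiSq r r' z z' := by unfold xiSq; positivity
  have hs2 : 0 < xiSq r r' z z' + 2 := by linarith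
  rw [Fm'_eq_cosCoeff, abs_mul, show |(-(1 / 2) : ℝ)| = 1 / 2 by norm_num]
  refine (mul_le_mul (weight_le hr hr' hD hA hB hAB) (mul_le_mul
    (mul_le_mul_of_nonneg_left (h m _ hm hs) (by norm_num)) (drift_le z z' hr hr')
    (by positivity) (by positivity)) (by positivity) (by positivity)).trans_eq ?_
  have e1 : xiSq r r' z z' ^ c * xiSq r r' z z' ^ (-(3 / 2 - 1 / 2) - (c - 1 / 2)) *
      xiSq r r' z z' ^ (1 / 2 : ℝ) = 1 := by
    rw [← Real.rpow_add hs, ← Real.rpow_add hs]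
    ring_nf
    exact Real.rpow_zero _
  have e2 : (xiSq r r' z z' + 2) ^ (7 / 2 - c) * (xiSq r r' z z' + 2) ^ (c - 1 / 2 - 7 / 2) *
      (xiSq r r' z z' + 2) ^ (1 / 2 : ℝ) = 1 := by
    rw [← Real.rpow_add hs2, ← Real.rpow_add hs2]
    ring_nf
    exact Real.rpow_zero _
  linear_combination 3 / 2 * C * (m : ℝ) ^ (-(c - 1 / 2)) *
    ((r - r') ^ 2 + (z - z') ^ 2) ^ (-c) *
    ((xiSq r r' z z' + 2) ^ (7 / 2 - c) * (xiSq r r' z z' + 2) ^ (c - 1 / 2 - 7 / 2) *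
      (xiSq r r' z z' + 2) ^ (1 / 2 : ℝ) * e1 + e2)

/-- Kernel estimates (a21) and (a22). -/
theorem kernel_estimates (p q α β : ℝ)
    (hq1 : 1 < q) (hqp : q < p)
    (hαβ : 0 < α + β) (hα : -3 ≤ α + 1/p) (hβ : -2 ≤ β - 1/q)
    (hscal : 1/q = 1/p + (α + β)/3) :
    ∃ ε₀ : ℝ, 0 < ε₀ ∧ ∀ ε : ℝ, 0 < ε → ε < ε₀ →
      ∃ C : ℝ, 0 < C ∧ ∀ m : ℕ, 3 ≤ m →
        ∀ r r' z z' : ℝ, 0 < r → 0 < r' →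
          (Htilde m p q α β r r' z z'
              ≤ C * (m : ℝ) ^ (-(1 + 1/p - 1/q - ε)) *
                ((r - r')^2 + (z - z')^2) ^ (-(1 + 1/p - 1/q))) ∧
          (0 < 1/2 + 1/p - 1/q →
            Hker m p q α β r r' z z'
              ≤ C * (m : ℝ) ^ (-(1/2 + 1/p - 1/q - ε)) *
                ((r - r')^2 + (z - z')^2) ^ (-(1 + 1/p - 1/q))) := by
  refine ⟨1, one_pos, fun ε hε _ => ?_⟩
  have hp0 : 0 < 1 / p := by have : 0 < p := by linarith
                             positivity
  have hq0 : 1 / q < 1 := (div_lt_one (by linarith)).mpr hq1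
  have hA : -(7 / 2) ≤ α + 1 / p - 1 / 2 := by linarith
  have hB : -(7 / 2) ≤ β - 1 / q - 3 / 2 := by linarith
  have hAB : α + 1 / p - 1 / 2 + (β - 1 / q - 3 / 2) = -2 * (1 + 1 / p - 1 / q) := by linarith
  have hmono : ∀ {m : ℕ} {a b : ℝ}, 3 ≤ m → a ≤ b → (m : ℝ) ^ a ≤ (m : ℝ) ^ b := fun hm hab =>
    Real.rpow_le_rpow_of_exponent_le (by exact_mod_cast (by omega : 1 ≤ _)) hab
  obtain ⟨C₁, hC₁, h₁⟩ := weight_mul_Fm_le hA hB hAB (by linarith) (by linarith)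
  by_cases hc : 0 < 1 / 2 + 1 / p - 1 / q
  · obtain ⟨C₂, hC₂, h₂⟩ := weight_mul_Fm'_le hA hB hAB (by linarith) (by linarith)
    refine ⟨C₁ + C₂, by positivity, fun m hm r r' z z' hr hr' => ⟨?_, fun _ => ?_⟩⟩
    · refine (h₁ m r r' z z' hm hr hr').trans ?_
      gcongr ?_ * ?_ * _
      · linarith
      · exact hmono hm (by linarith)
    · rw [Hker, mul_add, add_mul C₁, add_mul]
      refine add_le_add ((h₁ m r r' z z' hm hr hr').trans ?_)
        ((h₂ m r r' z z' hm hr hr').trans ?_)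
      · gcongr ?_ * ?_ * _
        exact hmono hm (by linarith)
      · gcongr ?_ * ?_ * _
        exact hmono hm (by linarith)
  · refine ⟨C₁, hC₁, fun m hm r r' z z' hr hr' => ⟨?_, fun h => absurd h hc⟩⟩
    refine (h₁ m r r' z z' hm hr hr').trans ?_
    gcongr ?_ * ?_ * _
    exact hmono hm (by linarith)

end
end

section
/- Let m ≥ 3 be an integer, let 1 < q < p < ∞, and let α, β ∈ ℝ satisfy α + β > 0, α + 1/p ≥ −2, β − 1/q ≥ −3, 1/q = 1/p + (α+β)/3, and 1/2 + 1/p − 1/q > 0. Then for every sufficiently small ε > 0 there is a constant C_ε, independent of m and f, such that for every smooth function f compactly supported in (0,∞)×ℝ: ‖r^{α} ∇̃ L_m^{-1}(r^{β−1} f)‖_{L^p} ≤ C_ε m^{−(1/2 + 1/p − 1/q − ε)} ‖f‖_{L^q}. -/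
open Real MeasureTheory Set

noncomputable section

/-- The explicit integral kernel realisation of
`L_m^{-1} = (−(∂_r² + ∂_r/r + ∂_z²) + m²/r²)^{-1}` on axisymmetric functions. -/
def Lminv (m : ℕ) (g : ℝ → ℝ → ℝ) (r z : ℝ) : ℝ :=
  (1/(2*Real.pi)) * ∫ r' in Set.Ioi (0:ℝ), ∫ z' : ℝ,
    Fm m (xiSq r r' z z') * g r' z' * Real.sqrt (r'/r)

/-- The `L^p(ℝ³)` norm of the axisymmetric function corresponding to `f(r,z)`:
`‖f‖_{L^p}^p = 2π ∫₀^∞ ∫_ℝ |f(r,z)|^p r dz dr`. -/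
def cylLp (p : ℝ) (f : ℝ → ℝ → ℝ) : ℝ :=
  (2*Real.pi * ∫ r in Set.Ioi (0:ℝ), ∫ z : ℝ, |f r z| ^ p * r) ^ (1/p)

/-- A smooth function compactly supported in `(0,∞) × ℝ`. -/
def TestFun (f : ℝ → ℝ → ℝ) : Prop :=
  ContDiff ℝ (⊤ : ℕ∞) (Function.uncurry f) ∧ HasCompactSupport (Function.uncurry f) ∧
    tsupport (Function.uncurry f) ⊆ Set.Ioi (0:ℝ) ×ˢ Set.univ

open scoped ENNReal

/-- `∫₀^π sin^{2j} θ · (s + 2(1 − cos θ))^{-e} dθ`. -/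
def sinPowIntegral (j : ℕ) (e s : ℝ) : ℝ :=
  ∫ θ in (0:ℝ)..Real.pi, sin θ ^ (2 * j) * (s + 2 * (1 - cos θ)) ^ (-e)

lemma denom_pos {s : ℝ} (hs : 0 < s) (θ : ℝ) : 0 < s + 2 * (1 - cos θ) := by
  linarith [cos_le_one θ]

lemma continuous_denom_rpow {s : ℝ} (hs : 0 < s) (e : ℝ) :
    Continuous fun θ : ℝ => (s + 2 * (1 - cos θ)) ^ e :=
  Continuous.rpow_const (by fun_prop) fun θ => Or.inl (denom_pos hs θ).ne'

lemma hasDerivAt_sinPowIntegral (j : ℕ) {e s : ℝ} (he : 0 ≤ e) (hs : 0 < s) :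
    HasDerivAt (sinPowIntegral j e) (-e * sinPowIntegral j (e + 1) s) s := by
  have key := (intervalIntegral.hasDerivAt_integral_of_dominated_loc_of_deriv_le
    (μ := volume) (a := 0) (b := Real.pi) (x₀ := s) (s := Set.Ioi (s / 2))
    (F := fun s θ => sin θ ^ (2 * j) * (s + 2 * (1 - cos θ)) ^ (-e))
    (F' := fun s θ => sin θ ^ (2 * j) * (-e * (s + 2 * (1 - cos θ)) ^ (-(e + 1))))
    (bound := fun _ => e * (s / 2) ^ (-(e + 1)))
    (Ioi_mem_nhds (by linarith)) ?_ ?_ ?_ ?_ ?_ ?_).2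
  · unfold sinPowIntegral
    refine key.congr_deriv ?_
    rw [← intervalIntegral.integral_const_mul]
    congr 1; ext θ; ring
  · filter_upwards [Ioi_mem_nhds hs] with x hx
    exact ((continuous_sin.pow _).mul (continuous_denom_rpow hx _)).aestronglyMeasurable
  · exact ((continuous_sin.pow _).mul (continuous_denom_rpow hs _)).intervalIntegrable _ _
  · exact ((continuous_sin.pow _).mul
      ((continuous_denom_rpow hs _).const_mul _)).aestronglyMeasurable
  · refine Filter.Eventually.of_forall fun θ _ x hx => ?_
    have hx' : s / 2 < x := hx
    have hD : s / 2 ≤ x + 2 * (1 - cos θ) := by linarith [cos_le_one θ]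
    have h2 : (0:ℝ) < s / 2 := by linarith
    rw [norm_mul, norm_mul, norm_pow, norm_neg, Real.norm_of_nonneg he,
      Real.norm_of_nonneg (rpow_nonneg (h2.le.trans hD) _)]
    have h3 : ‖sin θ‖ ^ (2 * j) ≤ 1 := pow_le_one₀ (norm_nonneg _) (abs_sin_le_one θ)
    have h4 : (x + 2 * (1 - cos θ)) ^ (-(e + 1)) ≤ (s / 2) ^ (-(e + 1)) :=
      rpow_le_rpow_of_nonpos h2 hD (by linarith)
    have h5 : 0 ≤ (x + 2 * (1 - cos θ)) ^ (-(e + 1)) := rpow_nonneg (h2.le.trans hD) _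
    calc _ ≤ 1 * (e * (x + 2 * (1 - cos θ)) ^ (-(e + 1))) := by gcongr
      _ ≤ _ := by rw [one_mul]; gcongr
  · exact intervalIntegrable_const
  · refine Filter.Eventually.of_forall fun θ _ x hx => ?_
    have hx' : s / 2 < x := hx
    have hD := denom_pos (show 0 < x by linarith) θ
    have h1 : HasDerivAt (fun x : ℝ => x + 2 * (1 - cos θ)) 1 x := (hasDerivAt_id x).add_const _
    have h2 := h1.rpow_const (p := -e) (Or.inl hD.ne')
    have h3 := h2.const_mul (sin θ ^ (2 * j))
    refine h3.congr_deriv ?_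
    rw [show -(e + 1) = -e - 1 by ring]; ring

lemma continuousOn_sinPowIntegral (j : ℕ) {e : ℝ} (he : 0 ≤ e) :
    ContinuousOn (sinPowIntegral j e) (Ioi 0) := fun _ hs =>
  (hasDerivAt_sinPowIntegral j he hs).continuousAt.continuousWithinAt

lemma hasDerivAt_denom_rpow {s : ℝ} (hs : 0 < s) (e θ : ℝ) :
    HasDerivAt (fun θ => (s + 2 * (1 - cos θ)) ^ e)
      (2 * sin θ * e * (s + 2 * (1 - cos θ)) ^ (e - 1)) θ := by
  have h1 : HasDerivAt (fun θ : ℝ => s + 2 * (1 - cos θ)) (2 * sin θ) θ := by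
    have := (((hasDerivAt_cos θ).const_sub 1).const_mul 2).const_add s
    simpa using this
  exact h1.rpow_const (p := e) (Or.inl (denom_pos hs θ).ne')

lemma Fm_eq_rpow (m : ℕ) {s : ℝ} (hs : 0 < s) :
    Fm m s = ∫ θ in (0:ℝ)..Real.pi, cos (m * θ) * (s + 2 * (1 - cos θ)) ^ (-(1/2:ℝ)) := by
  unfold Fm
  congr 1; ext θ
  rw [rpow_neg (denom_pos hs θ).le, ← sqrt_eq_rpow, div_eq_mul_inv]

lemma Fm_recurrence (n : ℕ) {s : ℝ} (hs : 0 < s) :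
    (2 * (n + 1 : ℕ) + 1) * Fm (n + 2) s
      = 2 * (n + 1 : ℕ) * (s + 2) * Fm (n + 1) s - (2 * (n + 1 : ℕ) - 1) * Fm n s := by
  set m : ℝ := ((n + 1 : ℕ) : ℝ) with hm
  have hD := fun θ => (denom_pos hs θ)
  have hderiv : ∀ θ ∈ uIcc 0 Real.pi, HasDerivAt
      (fun θ => 2 * (sin (m * θ) * (s + 2 * (1 - cos θ)) ^ (1/2:ℝ)))
      ((2 * m * cos (m * θ) * (s + 2 * (1 - cos θ)) + 2 * sin (m * θ) * sin θ) *
        (s + 2 * (1 - cos θ)) ^ (-(1/2:ℝ))) θ := by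
    intro θ _
    have h1 : HasDerivAt (fun θ => sin (m * θ)) (cos (m * θ) * (m * 1)) θ :=
      ((hasDerivAt_id θ).const_mul m).sin
    have h2 := (h1.mul (hasDerivAt_denom_rpow hs (1/2) θ)).const_mul 2
    refine h2.congr_deriv ?_
    have h3 : (s + 2 * (1 - cos θ)) ^ (1/2:ℝ)
        = (s + 2 * (1 - cos θ)) * (s + 2 * (1 - cos θ)) ^ (-(1/2:ℝ)) := by
      rw [← rpow_one_add' (hD θ).le (by norm_num)]; norm_num
    rw [h3, show (1/2:ℝ) - 1 = -(1/2) by norm_num]; ring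
  have hcont : ∀ g : ℝ → ℝ, Continuous g →
      IntervalIntegrable (fun θ => g θ * (s + 2 * (1 - cos θ)) ^ (-(1/2:ℝ))) volume 0 Real.pi :=
    fun g hg => (hg.mul (continuous_denom_rpow hs _)).intervalIntegrable _ _
  have h0 := intervalIntegral.integral_eq_sub_of_hasDerivAt hderiv (hcont _ (by fun_prop))
  have hsin : sin (m * Real.pi) = 0 := by rw [hm]; exact sin_nat_mul_pi _
  simp only [hsin, mul_zero, sin_zero, zero_mul, sub_zero] at h0
  have hn : (n : ℝ) = m - 1 := by rw [hm]; push_cast; ring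
  have hn2 : ((n + 2 : ℕ) : ℝ) = m + 1 := by rw [hm]; push_cast; ring
  rw [Fm_eq_rpow _ hs, Fm_eq_rpow _ hs, Fm_eq_rpow _ hs, hn, hn2, ← hm]
  rw [← sub_eq_zero, ← intervalIntegral.integral_const_mul, ← intervalIntegral.integral_const_mul,
    ← intervalIntegral.integral_const_mul, ← intervalIntegral.integral_sub,
    ← intervalIntegral.integral_sub]
  · rw [← neg_eq_zero, ← intervalIntegral.integral_neg, ← h0]
    congr 1; ext θ
    rw [add_mul m, sub_mul m, one_mul, cos_add, cos_sub]; ring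
  · exact (hcont (fun θ => cos ((m + 1) * θ)) (by fun_prop)).const_mul _
  · exact ((hcont (fun θ => cos (m * θ)) (by fun_prop)).const_mul _).sub
      ((hcont (fun θ => cos ((m - 1) * θ)) (by fun_prop)).const_mul _)
  · exact (hcont (fun θ => cos (m * θ)) (by fun_prop)).const_mul _
  · exact (hcont (fun θ => cos ((m - 1) * θ)) (by fun_prop)).const_mul _

lemma sinPowIntegral_recurrence (n : ℕ) {s : ℝ} (hs : 0 < s) :
    (2 * (n + 1 : ℕ) + 1) * sinPowIntegral (n + 2) ((n + 2 : ℕ) + 1/2) s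
      = 2 * (n + 1 : ℕ) * (s + 2) * sinPowIntegral (n + 1) ((n + 1 : ℕ) + 1/2) s
        - (2 * (n + 1 : ℕ) - 1) * sinPowIntegral n (n + 1/2) s := by
  set m : ℝ := ((n + 1 : ℕ) : ℝ) with hm
  have hn : (n : ℝ) = m - 1 := by rw [hm]; push_cast; ring
  have hn2 : ((n + 2 : ℕ) : ℝ) = m + 1 := by rw [hm]; push_cast; ring
  have hD := fun θ => (denom_pos hs θ)
  have hderiv : ∀ θ ∈ uIcc 0 Real.pi, HasDerivAt
      (fun θ => sin θ ^ (2 * n + 1) * (s + 2 * (1 - cos θ)) ^ (-(m + 1/2)) *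
        (-(sin θ ^ 2) + cos θ * (s + 2 * (1 - cos θ))))
      ((sin θ ^ (2 * n) * ((2 * m + 1) * sin θ ^ 4
        - 2 * m * (s + 2) * sin θ ^ 2 * (s + 2 * (1 - cos θ))
        + (2 * m - 1) * (s + 2 * (1 - cos θ)) ^ 2)) *
        (s + 2 * (1 - cos θ)) ^ (-(m + 3/2))) θ := by
    intro θ _
    have h1 := ((hasDerivAt_sin θ).pow (2 * n + 1)).mul (hasDerivAt_denom_rpow hs (-(m + 1/2)) θ)
    have h2 : HasDerivAt (fun θ => -(sin θ ^ 2) + cos θ * (s + 2 * (1 - cos θ)))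
        (-(2 * sin θ * cos θ) + (-sin θ * (s + 2 * (1 - cos θ)) + cos θ * (2 * sin θ))) θ := by
      have a1 := ((hasDerivAt_sin θ).pow 2).neg
      have a2 := (hasDerivAt_cos θ).mul
        ((((hasDerivAt_cos θ).const_sub 1).const_mul 2).const_add s)
      refine (a1.add a2).congr_deriv ?_
      simp
    have h3 := h1.mul h2
    refine h3.congr_deriv ?_
    have h4 : (s + 2 * (1 - cos θ)) ^ (-(m + 1/2))
        = (s + 2 * (1 - cos θ)) * (s + 2 * (1 - cos θ)) ^ (-(m + 3/2)) := by
      rw [← rpow_one_add' (hD θ).le]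
      · congr 1; ring
      · have : (0:ℝ) ≤ n := Nat.cast_nonneg n
        intro h; linarith
    have h5 : -(m + 1/2) - 1 = -(m + 3/2) := by ring
    have h6 : ((2 * n + 1 : ℕ) : ℝ) = 2 * m - 1 := by push_cast; rw [hn]; ring
    simp only [Pi.mul_apply, Pi.pow_apply, h4, h5, h6, Nat.add_sub_cancel]
    have h7 : cos θ ^ 2 = 1 - sin θ ^ 2 := by rw [cos_sq']
    have h8 : ∀ k : ℕ, sin θ ^ (2 * n + k) = sin θ ^ (2 * n) * sin θ ^ k := fun k => pow_add _ _ _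
    simp only [h8, pow_one]
    generalize sin θ ^ (2 * n) = A
    generalize (s + 2 * (1 - cos θ)) ^ (-(m + 3/2)) = E
    linear_combination (-1 : ℝ) * (-(A * E * (s + 2 * (1 - cos θ))) * ((2 * m - 1) * (s + 2 * (1 - cos θ)))) * h7
  have hcont : ∀ g : ℝ → ℝ, Continuous g → ∀ e : ℝ,
      IntervalIntegrable (fun θ => g θ * (s + 2 * (1 - cos θ)) ^ e) volume 0 Real.pi :=
    fun g hg e => (hg.mul (continuous_denom_rpow hs _)).intervalIntegrable _ _
  have h0 := intervalIntegral.integral_eq_sub_of_hasDerivAt hderiv (hcont _ (by fun_prop) _)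
  simp only [sin_pi, sin_zero, ne_eq, Nat.add_eq_zero_iff, one_ne_zero, and_false, not_false_eq_true,
    zero_pow, zero_mul, sub_zero] at h0
  unfold sinPowIntegral
  rw [hn, hn2, ← sub_eq_zero, ← intervalIntegral.integral_const_mul,
    ← intervalIntegral.integral_const_mul,
    ← intervalIntegral.integral_const_mul, ← intervalIntegral.integral_sub,
    ← intervalIntegral.integral_sub]
  · rw [← h0]
    congr 1; ext θ
    have h4 : (s + 2 * (1 - cos θ)) ^ (-(m + 1/2))
        = (s + 2 * (1 - cos θ)) * (s + 2 * (1 - cos θ)) ^ (-(m + 3/2)) := by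
      rw [← rpow_one_add' (hD θ).le]
      · congr 1; ring
      · have : (0:ℝ) ≤ n := Nat.cast_nonneg n
        intro h; linarith
    have h5 : (s + 2 * (1 - cos θ)) ^ (-(m - 1 + 1/2))
        = (s + 2 * (1 - cos θ)) ^ 2 * (s + 2 * (1 - cos θ)) ^ (-(m + 3/2)) := by
      rw [← rpow_natCast, ← rpow_add (hD θ)]
      congr 1; push_cast; ring
    rw [h4, h5, show -(m + 1 + 1/2) = -(m + 3/2) by ring]
    ring
  · exact (hcont _ (by fun_prop) _).const_mul _
  · exact ((hcont _ (by fun_prop) _).const_mul _).sub ((hcont _ (by fun_prop) _).const_mul _)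
  · exact (hcont _ (by fun_prop) _).const_mul _
  · exact (hcont _ (by fun_prop) _).const_mul _

lemma Fm_one_eq {s : ℝ} (hs : 0 < s) : Fm 1 s = sinPowIntegral 1 (1 + 1/2) s := by
  have hderiv : ∀ θ ∈ uIcc 0 Real.pi, HasDerivAt
      (fun θ => sin θ * (s + 2 * (1 - cos θ)) ^ (-(1/2:ℝ)))
      (cos θ * (s + 2 * (1 - cos θ)) ^ (-(1/2:ℝ))
        - sin θ ^ (2 * 1) * (s + 2 * (1 - cos θ)) ^ (-(1 + 1/2:ℝ))) θ := by
    intro θ _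
    refine ((hasDerivAt_sin θ).mul (hasDerivAt_denom_rpow hs (-(1/2)) θ)).congr_deriv ?_
    rw [show -(1/2:ℝ) - 1 = -(1 + 1/2) by norm_num]; ring
  have hcont : ∀ g : ℝ → ℝ, Continuous g → ∀ e : ℝ,
      IntervalIntegrable (fun θ => g θ * (s + 2 * (1 - cos θ)) ^ e) volume 0 Real.pi :=
    fun g hg e => (hg.mul (continuous_denom_rpow hs _)).intervalIntegrable _ _
  have hc1 := hcont cos continuous_cos (-(1/2))
  have hc2 := hcont (fun θ => sin θ ^ (2 * 1)) (by fun_prop) (-(1 + 1/2))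
  have h0 := intervalIntegral.integral_eq_sub_of_hasDerivAt hderiv (hc1.sub hc2)
  rw [intervalIntegral.integral_sub hc1 hc2] at h0
  simp only [sin_pi, sin_zero, zero_mul, sub_zero] at h0
  rw [Fm_eq_rpow _ hs]
  simp only [Nat.cast_one, one_mul]
  exact sub_eq_zero.1 h0

lemma Fm_eq_sinPowIntegral (m : ℕ) {s : ℝ} (hs : 0 < s) :
    Fm m s = sinPowIntegral m (m + 1/2) s := by
  induction m using Nat.strong_induction_on with
  | _ m ih =>
    match m, ih with
    | 0, _ => rw [Fm_eq_rpow _ hs, sinPowIntegral]; simp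
    | 1, _ => rw [Fm_one_eq hs]; simp
    | n + 2, ih =>
      have h1 := Fm_recurrence n hs
      rw [ih n (by omega), ih (n + 1) (by omega), ← sinPowIntegral_recurrence n hs] at h1
      exact mul_left_cancel₀ (by positivity) h1

lemma hasDerivAt_Fm (m : ℕ) {s : ℝ} (hs : 0 < s) :
    HasDerivAt (Fm m) (-(m + 1/2) * sinPowIntegral m (m + 1/2 + 1) s) s := by
  refine (hasDerivAt_sinPowIntegral m (e := m + 1/2) (by positivity) hs).congr_of_eventuallyEq ?_
  filter_upwards [Ioi_mem_nhds hs] with x hx using Fm_eq_sinPowIntegral m hx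

/-- The profile `min(s^{-κ}, s^{-7/2})` dominating `F_m` and `s F_m'`. -/
def decayProfile (κ s : ℝ) : ℝ := min (s ^ (-κ)) (s ^ (-(7/2:ℝ)))

lemma pow_le_of_le_one_sub {x w a : ℝ} {m : ℕ} (hm : 3 ≤ m) (hx0 : 0 ≤ x) (hw0 : 0 < w)
    (hw1 : w ≤ 1) (hxw : x ≤ 1 - w) (ha0 : 0 ≤ a) (ha2 : a ≤ 2) :
    x ^ m ≤ 2 * exp 3 * (x ^ 3 * (m * w) ^ (-a)) := by
  obtain ⟨k, rfl⟩ := Nat.exists_eq_add_of_le hm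
  have ht : 0 < ((3 + k : ℕ) : ℝ) * w := by positivity
  set t := ((3 + k : ℕ) : ℝ) * w with htdef
  have h1 : x ^ k ≤ exp 3 * exp (-t) := by
    calc x ^ k ≤ (exp (-w)) ^ k := by
          gcongr; linarith [add_one_le_exp (-w)]
      _ = exp (-(k * w)) := by rw [← exp_nat_mul]; ring_nf
      _ ≤ exp (3 + -t) := by
          apply exp_le_exp.2
          rw [htdef]; push_cast; nlinarith
      _ = _ := exp_add _ _
  have h2 : t ^ a ≤ 2 * exp t := by
    have h3 : t ^ a ≤ 1 + t ^ 2 := by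
      rcases le_total t 1 with h | h
      · have := rpow_le_one ht.le h ha0
        nlinarith [sq_nonneg t]
      · have := rpow_le_rpow_of_exponent_le h ha2
        rw [rpow_two] at this; linarith
    have := quadratic_le_exp_of_nonneg ht.le
    nlinarith
  have h3 : exp (-t) ≤ 2 * t ^ (-a) := by
    rw [exp_neg, rpow_neg ht.le, inv_eq_one_div, ← div_eq_mul_inv, div_le_div_iff₀ (exp_pos _)
      (rpow_pos_of_pos ht _)]
    linarith
  rw [pow_add]
  calc x ^ 3 * x ^ k ≤ x ^ 3 * (exp 3 * (2 * t ^ (-a))) := by gcongr; exact h1.trans (by gcongr)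
    _ = _ := by ring

section
variable {κ s : ℝ}

lemma sin_sq_div_denom_le (hs : 0 < s) (θ : ℝ) :
    sin θ ^ 2 / (s + 2 * (1 - cos θ)) ≤ 1 - s / (s + 2 * (1 - cos θ)) := by
  have hD := denom_pos hs θ
  rw [div_le_iff₀ hD, sub_mul, div_mul_cancel₀ _ hD.ne', sin_sq]
  nlinarith [sq_nonneg (1 - cos θ)]

lemma integrand_eq (hs : 0 < s) (m : ℕ) (b θ : ℝ) :
    sin θ ^ (2 * m) * (s + 2 * (1 - cos θ)) ^ (-(m + b))
      = (sin θ ^ 2 / (s + 2 * (1 - cos θ))) ^ m * (s + 2 * (1 - cos θ)) ^ (-b) := by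
  have hD := denom_pos hs θ
  rw [neg_add, rpow_add hD, rpow_neg hD.le, rpow_natCast, pow_mul, div_pow]
  ring

lemma integrand_le (hκ0 : 0 < κ) (hκ : κ < 1/2) (hs : 0 < s) {m : ℕ} (hm : 3 ≤ m) (θ : ℝ) :
    sin θ ^ (2 * m) * (s + 2 * (1 - cos θ)) ^ (-(m + 1/2 : ℝ))
      ≤ 4 * exp 3 * (m : ℝ) ^ (-κ) * s ^ (-κ) *
        ((sin θ ^ 2 / (s + 2 * (1 - cos θ))) ^ 3 * (s + 2 * (1 - cos θ)) ^ (κ - 1/2)) := by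
  have hD := denom_pos hs θ
  have hm0 : (0:ℝ) < m := by exact_mod_cast (by omega : 0 < m)
  rw [integrand_eq hs]
  have hx := sin_sq_div_denom_le hs θ
  have hsD : s ≤ s + 2 * (1 - cos θ) := by linarith [cos_le_one θ]
  have hx0 : 0 ≤ sin θ ^ 2 / (s + 2 * (1 - cos θ)) := by positivity
  set x := sin θ ^ 2 / (s + 2 * (1 - cos θ))
  set D := s + 2 * (1 - cos θ)
  have h1 := pow_le_of_le_one_sub hm hx0 (div_pos hs hD) ((div_le_one hD).2 hsD) hx hκ0.le
    (by linarith)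
  have h2 : (m * (s / D)) ^ (-κ) = (m : ℝ) ^ (-κ) * s ^ (-κ) * D ^ κ := by
    rw [mul_rpow hm0.le (by positivity), div_rpow hs.le hD.le, rpow_neg hD.le κ, div_inv_eq_mul]
    ring
  rw [h2] at h1
  have h3 : D ^ (κ - 1/2) = D ^ κ * D ^ (-(1/2:ℝ)) := by rw [← rpow_add hD]; rfl
  rw [h3]
  have h4 : 0 ≤ exp 3 * (m : ℝ) ^ (-κ) * s ^ (-κ) * (x ^ 3 * (D ^ κ * D ^ (-(1/2:ℝ)))) := by
    positivity
  calc x ^ m * D ^ (-(1/2:ℝ))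
      ≤ 2 * exp 3 * (x ^ 3 * ((m : ℝ) ^ (-κ) * s ^ (-κ) * D ^ κ)) * D ^ (-(1/2:ℝ)) := by gcongr
    _ = 2 * (exp 3 * (m : ℝ) ^ (-κ) * s ^ (-κ) * (x ^ 3 * (D ^ κ * D ^ (-(1/2:ℝ))))) := by ring
    _ ≤ _ := by linarith

lemma deriv_integrand_le (hκ0 : 0 < κ) (hκ : κ < 1/2) (hs : 0 < s) {m : ℕ} (hm : 3 ≤ m) (θ : ℝ) :
    s * (m + 1/2) * (sin θ ^ (2 * m) * (s + 2 * (1 - cos θ)) ^ (-(m + 1/2 + 1: ℝ)))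
      ≤ 4 * exp 3 * (m : ℝ) ^ (-κ) * s ^ (-κ) *
        ((sin θ ^ 2 / (s + 2 * (1 - cos θ))) ^ 3 * (s + 2 * (1 - cos θ)) ^ (κ - 1/2)) := by
  have hD := denom_pos hs θ
  have hm3 : (3:ℝ) ≤ m := by exact_mod_cast hm
  have hm0 : (0:ℝ) < m := by linarith
  rw [add_assoc, integrand_eq hs]
  have hx := sin_sq_div_denom_le hs θ
  have hsD : s ≤ s + 2 * (1 - cos θ) := by linarith [cos_le_one θ]
  have hx0 : 0 ≤ sin θ ^ 2 / (s + 2 * (1 - cos θ)) := by positivity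
  set x := sin θ ^ 2 / (s + 2 * (1 - cos θ))
  set D := s + 2 * (1 - cos θ)
  have h1 := pow_le_of_le_one_sub (a := κ + 1) hm hx0 (div_pos hs hD) ((div_le_one hD).2 hsD) hx
    (by linarith) (by linarith)
  have h2 : s * m * (m * (s / D)) ^ (-(κ + 1)) = (m : ℝ) ^ (-κ) * s ^ (-κ) * D ^ (κ + 1) := by
    rw [mul_rpow hm0.le (by positivity), div_rpow hs.le hD.le, rpow_neg hD.le, div_inv_eq_mul,
      show -(κ + 1) = -κ - 1 by ring, rpow_sub_one hm0.ne', rpow_sub_one hs.ne']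
    field_simp
  have h3 : D ^ (κ - 1/2) = D ^ (κ + 1) * D ^ (-(1/2 + 1:ℝ)) := by
    rw [← rpow_add hD]; congr 1; ring
  rw [h3]
  have h5 : (m : ℝ) + 1/2 ≤ 2 * m := by linarith
  calc s * (m + 1/2) * (x ^ m * D ^ (-(1/2 + 1:ℝ)))
      ≤ s * (2 * m) * ((2 * exp 3 * (x ^ 3 * (m * (s / D)) ^ (-(κ + 1)))) * D ^ (-(1/2 + 1:ℝ))) := by
        gcongr
    _ = 4 * exp 3 * (s * m * (m * (s / D)) ^ (-(κ + 1))) * x ^ 3 * D ^ (-(1/2 + 1:ℝ)) := by ring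
    _ = _ := by rw [h2]; ring

lemma weight_le_of_sq (hκ : κ < 1/2) (hs : 0 < s) {θ : ℝ} (hθ0 : 0 < θ) (hθ : θ ≤ Real.pi) :
    (sin θ ^ 2 / (s + 2 * (1 - cos θ))) ^ 3 * (s + 2 * (1 - cos θ)) ^ (κ - 1/2)
      ≤ (4 / Real.pi ^ 2) ^ (κ - 1/2) * θ ^ (2 * κ - 1) := by
  have hD := denom_pos hs θ
  have hx := sin_sq_div_denom_le hs θ
  have hx1 : sin θ ^ 2 / (s + 2 * (1 - cos θ)) ≤ 1 := hx.trans (by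
    have : 0 < s / (s + 2 * (1 - cos θ)) := by positivity
    linarith)
  have hcos := Real.cos_le_one_sub_mul_cos_sq (x := θ) (by rw [abs_of_pos hθ0]; exact hθ)
  have hu : 4 / Real.pi ^ 2 * θ ^ 2 ≤ s + 2 * (1 - cos θ) := by
    have : 4 / Real.pi ^ 2 * θ ^ 2 = 2 * (2 / Real.pi ^ 2 * θ ^ 2) := by ring
    linarith
  calc _ ≤ 1 * (4 / Real.pi ^ 2 * θ ^ 2) ^ (κ - 1/2) := by
        refine mul_le_mul (pow_le_one₀ (by positivity) hx1) ?_ (by positivity) zero_le_one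
        exact rpow_le_rpow_of_nonpos (by positivity) hu (by linarith)
    _ = _ := by
        rw [one_mul, mul_rpow (by positivity) (by positivity), ← rpow_natCast θ 2,
          ← rpow_mul hθ0.le]
        congr 2; push_cast; ring

lemma weight_le_s13 (hκ : κ < 1/2) (hs : 0 < s) (θ : ℝ) :
    (sin θ ^ 2 / (s + 2 * (1 - cos θ))) ^ 3 * (s + 2 * (1 - cos θ)) ^ (κ - 1/2)
      ≤ s ^ (κ - 7/2) := by
  have hD := denom_pos hs θ
  have hsD : s ≤ s + 2 * (1 - cos θ) := by linarith [cos_le_one θ]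
  have hx1 : sin θ ^ 2 / (s + 2 * (1 - cos θ)) ≤ s⁻¹ := by
    rw [inv_eq_one_div]; gcongr; exact sin_sq_le_one θ
  have hx0 : 0 ≤ sin θ ^ 2 / (s + 2 * (1 - cos θ)) := by positivity
  calc _ ≤ (s⁻¹) ^ 3 * s ^ (κ - 1/2) := by
        refine mul_le_mul (pow_le_pow_left₀ hx0 hx1 3) ?_ (by positivity) (by positivity)
        exact rpow_le_rpow_of_nonpos hs hsD (by linarith)
    _ = _ := by
        rw [← rpow_neg_one, ← rpow_natCast, ← rpow_mul hs.le, ← rpow_add hs]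
        congr 1; push_cast; ring

lemma integral_le_decayProfile (hκ0 : 0 < κ) (hκ : κ < 1/2) (hs : 0 < s) {G : ℝ → ℝ} {A : ℝ}
    (hA : 0 ≤ A) (hG : IntervalIntegrable G volume 0 Real.pi)
    (hle : ∀ θ, G θ ≤ A * s ^ (-κ) *
        ((sin θ ^ 2 / (s + 2 * (1 - cos θ))) ^ 3 * (s + 2 * (1 - cos θ)) ^ (κ - 1/2))) :
    ∫ θ in (0:ℝ)..Real.pi, G θ ≤
      A * (Real.pi + (4 / Real.pi ^ 2) ^ (κ - 1/2) * (Real.pi ^ (2 * κ) / (2 * κ)))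
        * decayProfile κ s := by
  have hB : 0 ≤ (4 / Real.pi ^ 2) ^ (κ - 1/2) * (Real.pi ^ (2 * κ) / (2 * κ)) := by positivity
  have hpi := Real.pi_pos
  unfold decayProfile
  rw [mul_min_of_nonneg _ _ (by positivity)]
  refine le_min ?_ ?_
  · have h1 : IntervalIntegrable (fun θ : ℝ => A * s ^ (-κ) *
        ((4 / Real.pi ^ 2) ^ (κ - 1/2) * θ ^ (2 * κ - 1))) volume 0 Real.pi :=
      ((intervalIntegral.intervalIntegrable_rpow' (by linarith)).const_mul _).const_mul _
    refine (intervalIntegral.integral_mono_on_of_le_Ioo hpi.le hG h1 fun θ hθ =>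
      (hle θ).trans ?_).trans ?_
    · have := weight_le_of_sq hκ hs hθ.1 hθ.2.le
      gcongr
    · rw [intervalIntegral.integral_const_mul, intervalIntegral.integral_const_mul,
        integral_rpow (Or.inl (by linarith)), sub_add_cancel, zero_rpow (by linarith), sub_zero]
      have : 0 ≤ A * Real.pi * s ^ (-κ) := by positivity
      linarith
  · refine (intervalIntegral.integral_mono_on_of_le_Ioo hpi.le hG
      (intervalIntegrable_const (c := A * s ^ (-(7/2:ℝ)))) fun θ hθ => (hle θ).trans ?_).trans ?_
    · rw [mul_assoc]
      gcongr
      calc _ ≤ s ^ (-κ) * s ^ (κ - 7/2) := by gcongr; exact weight_le_s13 hκ hs θ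
        _ = _ := by rw [← rpow_add hs]; congr 1; ring
    · rw [intervalIntegral.integral_const, smul_eq_mul, sub_zero]
      have : 0 ≤ A * ((4 / Real.pi ^ 2) ^ (κ - 1/2) * (Real.pi ^ (2 * κ) / (2 * κ)))
        * s ^ (-(7/2:ℝ)) := by positivity
      linarith

end

lemma exists_Fm_bound {κ : ℝ} (hκ0 : 0 < κ) (hκ : κ < 1/2) :
    ∃ C : ℝ, 0 < C ∧ ∀ m : ℕ, 3 ≤ m → ∀ s : ℝ, 0 < s →
      |Fm m s| ≤ C * (m : ℝ) ^ (-κ) * decayProfile κ s ∧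
      s * |deriv (Fm m) s| ≤ C * (m : ℝ) ^ (-κ) * decayProfile κ s := by
  refine ⟨4 * exp 3 * (Real.pi + (4 / Real.pi ^ 2) ^ (κ - 1/2) * (Real.pi ^ (2 * κ) / (2 * κ))),
    by positivity, fun m hm s hs => ?_⟩
  have hpi := Real.pi_pos
  have hcont : ∀ e : ℝ, IntervalIntegrable
      (fun θ => sin θ ^ (2 * m) * (s + 2 * (1 - cos θ)) ^ e) volume 0 Real.pi :=
    fun e => ((continuous_sin.pow _).mul (continuous_denom_rpow hs _)).intervalIntegrable _ _
  have hnn : ∀ e : ℝ, 0 ≤ sinPowIntegral m e s := fun e =>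
    intervalIntegral.integral_nonneg hpi.le fun θ _ => by
      have := denom_pos hs θ
      rw [pow_mul]; positivity
  constructor
  · rw [Fm_eq_sinPowIntegral m hs, abs_of_nonneg (hnn _)]
    refine (integral_le_decayProfile hκ0 hκ hs (A := 4 * exp 3 * (m : ℝ) ^ (-κ)) (by positivity)
      (hcont _) fun θ => integrand_le hκ0 hκ hs hm θ).trans_eq (by ring)
  · rw [(hasDerivAt_Fm m hs).deriv, abs_mul, abs_neg, abs_of_nonneg (hnn _),
      abs_of_nonneg (by positivity), ← mul_assoc, sinPowIntegral,
      ← intervalIntegral.integral_const_mul]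
    refine (integral_le_decayProfile hκ0 hκ hs (A := 4 * exp 3 * (m : ℝ) ^ (-κ)) (by positivity)
      ((hcont _).const_mul _) fun θ => deriv_integrand_le hκ0 hκ hs hm θ).trans_eq (by ring)

/-- A generalized Young inequality for integral operators whose kernel is uniformly `L^σ` in each
variable, `1/σ = 1 + 1/p - 1/q`. -/
lemma lintegral_rpow_kernel_le {X Y : Type*} [MeasurableSpace X] [MeasurableSpace Y]
    {μ : Measure X} {ν : Measure Y} [SFinite μ] [SFinite ν] {p q σ : ℝ} (hq : 1 < q) (hqp : q < p)
    (hσ : 0 < σ) (hpqσ : 1 / σ = 1 + 1 / p - 1 / q) {K : X → Y → ℝ≥0∞}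
    (hK : Measurable (Function.uncurry K)) {h : Y → ℝ≥0∞} (hh : Measurable h) {A : ℝ≥0∞}
    (hA1 : ∀ᵐ x ∂μ, ∫⁻ y, K x y ^ σ ∂ν ≤ A) (hA2 : ∀ᵐ y ∂ν, ∫⁻ x, K x y ^ σ ∂μ ≤ A) :
    ∫⁻ x, (∫⁻ y, K x y * h y ∂ν) ^ p ∂μ ≤ A ^ (p / σ) * (∫⁻ y, h y ^ q ∂ν) ^ (p / q) := by
  have hq0 : 0 < q := by linarith
  have hp0 : 0 < p := by linarith
  have e1 : 0 ≤ 1 / p := by positivity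
  have e2 : 0 ≤ 1 - 1 / q := by rw [sub_nonneg, div_le_one hq0]; exact hq.le
  have e3 : 0 ≤ 1 / q - 1 / p := sub_nonneg.2 (one_div_le_one_div_of_le hq0 hqp.le)
  have hKx : ∀ x, Measurable (K x) := fun x => hK.comp measurable_prodMk_left
  have hKy : ∀ y, Measurable fun x => K x y := fun y => hK.comp measurable_prodMk_right
  have holder : ∀ x, ∫⁻ y, K x y * h y ∂ν ≤ (∫⁻ y, K x y ^ σ * h y ^ q ∂ν) ^ (1 / p) *
      (∫⁻ y, K x y ^ σ ∂ν) ^ (1 - 1 / q) * (∫⁻ y, h y ^ q ∂ν) ^ (1 / q - 1 / p) := by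
    intro x
    have := ENNReal.lintegral_prod_norm_pow_le (μ := ν) (Finset.univ : Finset (Fin 3))
      (f := ![fun y => K x y ^ σ * h y ^ q, fun y => K x y ^ σ, fun y => h y ^ q])
      (p := ![1 / p, 1 - 1 / q, 1 / q - 1 / p]) ?_ ?_ ?_
    · simp only [Fin.prod_univ_three, Matrix.cons_val_zero, Matrix.cons_val_one,
        Matrix.cons_val] at this
      refine le_trans (le_of_eq ?_) this
      refine lintegral_congr fun y => ?_
      rw [ENNReal.mul_rpow_of_nonneg _ _ e1, ← ENNReal.rpow_mul, ← ENNReal.rpow_mul,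
        ← ENNReal.rpow_mul, ← ENNReal.rpow_mul]
      calc K x y * h y = K x y ^ (σ * (1 / p) + σ * (1 - 1 / q)) *
            h y ^ (q * (1 / p) + q * (1 / q - 1 / p)) := by
            have s1 : σ * (1 / p) + σ * (1 - 1 / q) = 1 := by
              rw [← mul_add, show 1 / p + (1 - 1 / q) = 1 / σ by rw [hpqσ]; ring,
                mul_one_div_cancel hσ.ne']
            have s2 : q * (1 / p) + q * (1 / q - 1 / p) = 1 := by
              rw [← mul_add, add_sub_cancel, mul_one_div_cancel hq0.ne']
            rw [s1, s2, ENNReal.rpow_one, ENNReal.rpow_one]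
        _ = _ := by
            rw [ENNReal.rpow_add_of_nonneg _ _ (by positivity) (by positivity),
              ENNReal.rpow_add_of_nonneg _ _ (by positivity) (by positivity)]
            ring
    · intro i _
      fin_cases i
      · exact (((hKx x).pow_const σ).mul (hh.pow_const q)).aemeasurable
      · exact ((hKx x).pow_const σ).aemeasurable
      · exact (hh.pow_const q).aemeasurable
    · simp [Fin.sum_univ_three]
      ring
    · intro i _
      fin_cases i
      · exact e1
      · exact e2
      · exact e3
  set Y := ∫⁻ y, h y ^ q ∂ν with hY
  have hpow : ∀ᵐ x ∂μ, (∫⁻ y, K x y * h y ∂ν) ^ p ≤ (∫⁻ y, K x y ^ σ * h y ^ q ∂ν) *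
      (A ^ ((1 - 1 / q) * p) * Y ^ ((1 / q - 1 / p) * p)) := by
    filter_upwards [hA1] with x hx
    calc (∫⁻ y, K x y * h y ∂ν) ^ p ≤ ((∫⁻ y, K x y ^ σ * h y ^ q ∂ν) ^ (1 / p) *
          A ^ (1 - 1 / q) * Y ^ (1 / q - 1 / p)) ^ p := by
          refine ENNReal.rpow_le_rpow ((holder x).trans ?_) hp0.le
          gcongr
      _ = _ := by
          rw [ENNReal.mul_rpow_of_nonneg _ _ hp0.le, ENNReal.mul_rpow_of_nonneg _ _ hp0.le,
            ← ENNReal.rpow_mul, ← ENNReal.rpow_mul, ← ENNReal.rpow_mul,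
            one_div_mul_cancel hp0.ne', ENNReal.rpow_one, mul_assoc]
  have hmeas : Measurable (Function.uncurry fun x y => K x y ^ σ * h y ^ q) :=
    (hK.pow_const σ).mul ((hh.comp measurable_snd).pow_const q)
  calc ∫⁻ x, (∫⁻ y, K x y * h y ∂ν) ^ p ∂μ
      ≤ ∫⁻ x, (∫⁻ y, K x y ^ σ * h y ^ q ∂ν) *
          (A ^ ((1 - 1 / q) * p) * Y ^ ((1 / q - 1 / p) * p)) ∂μ := lintegral_mono_ae hpow
    _ = (∫⁻ x, ∫⁻ y, K x y ^ σ * h y ^ q ∂ν ∂μ) *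
          (A ^ ((1 - 1 / q) * p) * Y ^ ((1 / q - 1 / p) * p)) :=
        lintegral_mul_const _ hmeas.lintegral_prod_right'
    _ ≤ (A * Y) * (A ^ ((1 - 1 / q) * p) * Y ^ ((1 / q - 1 / p) * p)) := by
        gcongr
        rw [lintegral_lintegral_swap hmeas.aemeasurable, hY,
          ← lintegral_const_mul _ (hh.pow_const q)]
        refine lintegral_mono_ae ?_
        filter_upwards [hA2] with y hy
        rw [lintegral_mul_const _ ((hKy y).pow_const σ)]
        gcongr
    _ = A ^ (p / σ) * Y ^ (p / q) := by
        have s1 : p / σ = 1 + (1 - 1 / q) * p := by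
          rw [div_eq_mul_one_div, hpqσ]; field_simp; ring
        have s2 : p / q = 1 + (1 / q - 1 / p) * p := by field_simp; ring
        rw [s1, s2, ENNReal.rpow_add_of_nonneg _ _ zero_le_one (by positivity),
          ENNReal.rpow_add_of_nonneg _ _ zero_le_one (by positivity), ENNReal.rpow_one,
          ENNReal.rpow_one]
        ring

lemma lintegral_comp_const_mul {c : ℝ} (hc : 0 < c) {G : ℝ → ℝ≥0∞} (hG : Measurable G) :
    ∫⁻ t, G (c * t) = ENNReal.ofReal c⁻¹ * ∫⁻ t, G t := by
  rw [← lintegral_map hG (measurable_const_mul c), Real.map_volume_mul_left hc.ne',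
    lintegral_smul_measure, abs_of_pos (inv_pos.2 hc), smul_eq_mul]

lemma lintegral_Ioi_comp_const_mul {c : ℝ} (hc : 0 < c) {G : ℝ → ℝ≥0∞} (hG : Measurable G) :
    ∫⁻ t in Ioi 0, G (c * t) = ENNReal.ofReal c⁻¹ * ∫⁻ t in Ioi 0, G t := by
  rw [← lintegral_indicator measurableSet_Ioi, ← lintegral_indicator measurableSet_Ioi,
    ← lintegral_comp_const_mul hc (hG.indicator measurableSet_Ioi)]
  refine lintegral_congr fun t => ?_
  simp only [indicator, mem_Ioi, mul_pos_iff_of_pos_left hc]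

lemma intervalIntegrable_abs_rpow {e : ℝ} (he : -1 < e) (a b : ℝ) :
    IntervalIntegrable (fun x : ℝ => |x| ^ e) volume a b := by
  have h1 : ∀ b : ℝ, 0 ≤ b → IntervalIntegrable (fun x : ℝ => |x| ^ e) volume 0 b := fun b hb => by
    refine (intervalIntegral.intervalIntegrable_rpow' (a := 0) (b := b) he).congr fun x hx => ?_
    rw [uIoc_of_le hb] at hx
    simp only [abs_of_pos hx.1]
  have h2 : ∀ b : ℝ, IntervalIntegrable (fun x : ℝ => |x| ^ e) volume 0 b := fun b => by
    rcases le_total 0 b with hb | hb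
    · exact h1 b hb
    · rw [IntervalIntegrable.iff_comp_neg]
      simpa using h1 (-b) (by linarith)
  exact (h2 a).symm.trans (h2 b)

lemma exists_lintegral_sq_add_sq_rpow_le {μ : ℝ} (hμ : 1 < μ) :
    ∃ C : ℝ, 0 ≤ C ∧ ∀ a : ℝ, 0 < a → ∀ z₀ : ℝ,
      ∫⁻ z : ℝ, ENNReal.ofReal ((a ^ 2 + (z - z₀) ^ 2) ^ (-μ / 2))
        ≤ ENNReal.ofReal (C * a ^ (1 - μ)) := by
  have hinteg : Integrable (fun z : ℝ => (1 + ‖z‖ ^ 2) ^ (-μ / 2)) volume :=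
    integrable_rpow_neg_one_add_norm_sq (by simpa using hμ)
  refine ⟨∫ z : ℝ, (1 + ‖z‖ ^ 2) ^ (-μ / 2), integral_nonneg fun z => by positivity,
    fun a ha z₀ => ?_⟩
  rw [lintegral_sub_right_eq_self (fun z : ℝ => ENNReal.ofReal ((a ^ 2 + z ^ 2) ^ (-μ / 2))) z₀]
  have hG : Measurable fun z : ℝ => ENNReal.ofReal ((a ^ 2 + z ^ 2) ^ (-μ / 2)) := by fun_prop
  have h1 := lintegral_comp_const_mul ha hG
  have h2 : ∀ z : ℝ, ENNReal.ofReal ((a ^ 2 + (a * z) ^ 2) ^ (-μ / 2))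
      = ENNReal.ofReal (a ^ (-μ)) * ENNReal.ofReal ((1 + ‖z‖ ^ 2) ^ (-μ / 2)) := fun z => by
    rw [← ENNReal.ofReal_mul (by positivity)]
    congr 1
    rw [show a ^ 2 + (a * z) ^ 2 = a ^ 2 * (1 + ‖z‖ ^ 2) by rw [norm_eq_abs, sq_abs]; ring,
      mul_rpow (by positivity) (by positivity), ← rpow_natCast a 2, ← rpow_mul ha.le]
    congr 2; push_cast; ring
  have hc : ENNReal.ofReal a * ENNReal.ofReal a⁻¹ = 1 := by
    rw [← ENNReal.ofReal_mul ha.le, mul_inv_cancel₀ ha.ne', ENNReal.ofReal_one]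
  rw [lintegral_congr h2, lintegral_const_mul _ (by fun_prop),
    ← ofReal_integral_eq_lintegral_ofReal hinteg (.of_forall fun z => by positivity)] at h1
  rw [← one_mul (∫⁻ _, _), ← hc, mul_assoc, ← h1, ← ENNReal.ofReal_mul (by positivity),
    ← ENNReal.ofReal_mul ha.le]
  refine le_of_eq (congrArg _ ?_)
  rw [sub_eq_add_neg, rpow_add ha, rpow_one]; ring

/-- A homogeneous kernel of degree zero on the half-line. -/
def radialKernel (a b ν r t : ℝ) : ℝ :=
  r ^ a * t ^ b * max r t ^ (ν - a - b) * |r - t| ^ (-ν)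

lemma radialKernel_symm (a b ν r t : ℝ) : radialKernel a b ν r t = radialKernel b a ν t r := by
  unfold radialKernel
  rw [max_comm, abs_sub_comm, sub_right_comm, mul_comm (r ^ a)]

lemma measurable_radialKernel (a b ν : ℝ) :
    Measurable (Function.uncurry (radialKernel a b ν)) := by
  unfold radialKernel Function.uncurry
  fun_prop

lemma radialKernel_smul (a b ν : ℝ) {r t : ℝ} (hr : 0 < r) (ht : 0 < t) :
    radialKernel a b ν r (r * t) = radialKernel a b ν 1 t := by
  unfold radialKernel
  have h1 : max r (r * t) = r * max 1 t := by rw [mul_max_of_nonneg _ _ hr.le, mul_one]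
  have h2 : |r - r * t| = r * |1 - t| := by rw [← abs_of_pos hr, ← abs_mul, abs_of_pos hr]; ring_nf
  have h3 : (0:ℝ) < max 1 t := lt_max_of_lt_left one_pos
  rw [h1, h2, mul_rpow hr.le ht.le, mul_rpow hr.le h3.le, mul_rpow hr.le (abs_nonneg _), one_rpow]
  have h4 : r ^ a * r ^ b * r ^ (ν - a - b) * r ^ (-ν) = 1 := by
    rw [← rpow_add hr, ← rpow_add hr, ← rpow_add hr]; ring_nf; exact rpow_zero r
  linear_combination (t ^ b * max 1 t ^ (ν - a - b) * |1 - t| ^ (-ν)) * h4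

lemma integrableOn_radialKernel_one {a b ν : ℝ} (ha : 0 < a) (hb : 0 < b) (hν0 : 0 < ν)
    (hν : ν < 1) : IntegrableOn (fun t => radialKernel a b ν 1 t * t⁻¹) (Ioi 0) := by
  have hm : Measurable fun t => radialKernel a b ν 1 t * t⁻¹ :=
    ((measurable_radialKernel a b ν).comp measurable_prodMk_left).mul measurable_inv
  have h1 : IntegrableOn (fun t => radialKernel a b ν 1 t * t⁻¹) (Ioc 0 (1/2)) := by
    have := (intervalIntegral.intervalIntegrable_rpow' (a := 0) (b := 1/2)
      (r := b - 1) (by linarith)).const_mul ((1/2 : ℝ) ^ (-ν))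
    rw [intervalIntegrable_iff_integrableOn_Ioc_of_le (by norm_num)] at this
    refine Integrable.mono' this hm.aestronglyMeasurable ?_
    filter_upwards [ae_restrict_mem measurableSet_Ioc] with t ht
    have ht0 := ht.1
    have ht1 := ht.2
    unfold radialKernel
    rw [max_eq_left (by linarith), one_rpow, one_rpow, abs_of_pos (by linarith), one_mul, mul_one,
      norm_of_nonneg (mul_nonneg (mul_nonneg (by positivity) (rpow_nonneg (by linarith) _))
        (by positivity)), rpow_sub_one ht0.ne']
    have : (1 - t) ^ (-ν) ≤ (1/2 : ℝ) ^ (-ν) :=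
      rpow_le_rpow_of_nonpos (by norm_num) (by linarith) (by linarith)
    calc t ^ b * (1 - t) ^ (-ν) * t⁻¹ ≤ t ^ b * (1/2 : ℝ) ^ (-ν) * t⁻¹ := by gcongr
      _ = _ := by ring
  have h2 : IntegrableOn (fun t => radialKernel a b ν 1 t * t⁻¹) (Ioc (1/2) 2) := by
    have h0 := ((intervalIntegrable_abs_rpow (e := -ν) (by linarith) (1 - 1/2) (1 - 2)).comp_sub_left
      1)
    have := h0.const_mul ((2:ℝ) ^ b * 2 ^ |ν - a - b| * 2)
    norm_num at this
    rw [intervalIntegrable_iff_integrableOn_Ioc_of_le (by norm_num)] at this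
    refine Integrable.mono' this hm.aestronglyMeasurable ?_
    filter_upwards [ae_restrict_mem measurableSet_Ioc] with t ht
    have ht1 := ht.1
    have ht0 : 0 < t := by linarith
    have ht2 := ht.2
    have hmax : (1:ℝ) ≤ max 1 t := le_max_left _ _
    have hmax2 : max 1 t ≤ 2 := max_le (by norm_num) ht2
    unfold radialKernel
    rw [one_rpow, one_mul, norm_of_nonneg (by positivity)]
    have e1 : t ^ b ≤ 2 ^ b := rpow_le_rpow ht0.le ht2 hb.le
    have e2 : max 1 t ^ (ν - a - b) ≤ 2 ^ |ν - a - b| :=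
      (rpow_le_rpow_of_exponent_le hmax (le_abs_self _)).trans
        (rpow_le_rpow (by positivity) hmax2 (abs_nonneg _))
    have e3 : t⁻¹ ≤ 2 := by rw [inv_le_comm₀ ht0 (by norm_num)]; linarith
    calc t ^ b * max 1 t ^ (ν - a - b) * |1 - t| ^ (-ν) * t⁻¹
        ≤ 2 ^ b * 2 ^ |ν - a - b| * |1 - t| ^ (-ν) * 2 := by gcongr
      _ = _ := by ring
  have h3 : IntegrableOn (fun t => radialKernel a b ν 1 t * t⁻¹) (Ioi 2) := by
    have := (integrableOn_Ioi_rpow_of_lt (a := -a - 1) (c := 2) (by linarith)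
      (by norm_num)).const_mul ((1/2 : ℝ) ^ (-ν))
    refine Integrable.mono' this hm.aestronglyMeasurable ?_
    filter_upwards [ae_restrict_mem measurableSet_Ioi] with t ht
    have ht1 : 2 < t := ht
    have ht0 : 0 < t := by linarith
    unfold radialKernel
    rw [max_eq_right (by linarith), one_rpow, one_mul, norm_of_nonneg (by positivity)]
    have e1 : |1 - t| ^ (-ν) ≤ (1/2) ^ (-ν) * t ^ (-ν) := by
      rw [← mul_rpow (by norm_num) ht0.le]
      refine rpow_le_rpow_of_nonpos (by positivity) ?_ (by linarith)
      rw [abs_of_neg (by linarith)]; linarith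
    have e2 : t ^ b * t ^ (ν - a - b) * t ^ (-ν) * t⁻¹ = t ^ (-a - 1) := by
      rw [← rpow_add ht0, ← rpow_add ht0, ← rpow_neg_one, ← rpow_add ht0]; ring_nf
    calc t ^ b * t ^ (ν - a - b) * |1 - t| ^ (-ν) * t⁻¹
        ≤ t ^ b * t ^ (ν - a - b) * ((1/2) ^ (-ν) * t ^ (-ν)) * t⁻¹ := by gcongr
      _ = _ := by rw [← e2]; ring
  have hcover : Ioi (0:ℝ) = Ioc 0 (1/2) ∪ Ioc (1/2) 2 ∪ Ioi 2 := by
    rw [Ioc_union_Ioc_eq_Ioc (by norm_num) (by norm_num), Ioc_union_Ioi_eq_Ioi (by norm_num)]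
  rw [hcover]
  exact (h1.union h2).union h3

lemma exists_lintegral_radialKernel_le {a b ν : ℝ} (ha : 0 < a) (hb : 0 < b) (hν0 : 0 < ν)
    (hν : ν < 1) : ∃ C : ℝ≥0∞, C ≠ ∞ ∧ ∀ r : ℝ, 0 < r →
      ∫⁻ t in Ioi 0, ENNReal.ofReal (radialKernel a b ν r t * t⁻¹) ≤ C := by
  refine ⟨∫⁻ t in Ioi 0, ENNReal.ofReal (radialKernel a b ν 1 t * t⁻¹),
    (integrableOn_radialKernel_one ha hb hν0 hν).lintegral_lt_top.ne, fun r hr => ?_⟩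
  have hm : Measurable fun t => ENNReal.ofReal (radialKernel a b ν r t * t⁻¹) :=
    (((measurable_radialKernel a b ν).comp measurable_prodMk_left).mul measurable_inv).ennreal_ofReal
  have hc : ENNReal.ofReal r * ENNReal.ofReal r⁻¹ = 1 := by
    rw [← ENNReal.ofReal_mul hr.le, mul_inv_cancel₀ hr.ne', ENNReal.ofReal_one]
  rw [← one_mul (∫⁻ _ in _, ENNReal.ofReal (radialKernel a b ν r _ * _)), ← hc, mul_assoc,
    ← lintegral_Ioi_comp_const_mul hr hm, ← lintegral_const_mul' _ _ ENNReal.ofReal_ne_top]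
  refine setLIntegral_mono_ae' measurableSet_Ioi (.of_forall fun t ht => ?_)
  rw [← ENNReal.ofReal_mul hr.le, radialKernel_smul a b ν hr ht]
  refine le_of_eq (congrArg _ ?_)
  have : t ≠ 0 := ne_of_gt ht
  field_simp

/-- Lebesgue measure on the half-plane `(0,∞) × ℝ`. -/
def halfPlane : Measure (ℝ × ℝ) := (volume.restrict (Ioi 0)).prod volume

instance : SFinite halfPlane := by unfold halfPlane; infer_instance

lemma halfPlane_eq_restrict : halfPlane = volume.restrict (Ioi 0 ×ˢ univ) := by
  rw [halfPlane, Measure.volume_eq_prod, ← Measure.prod_restrict, Measure.restrict_univ]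

lemma ae_halfPlane_pos : ∀ᵐ x ∂halfPlane, 0 < x.1 := by
  rw [halfPlane_eq_restrict]
  filter_upwards [ae_restrict_mem (measurableSet_Ioi.prod MeasurableSet.univ)] with x hx using hx.1

lemma lintegral_halfPlane {G : ℝ × ℝ → ℝ≥0∞} (hG : Measurable G) :
    ∫⁻ x, G x ∂halfPlane = ∫⁻ r in Ioi 0, ∫⁻ z, G (r, z) :=
  lintegral_prod _ hG.aemeasurable

/-- The kernel dominating both derivatives of the kernel of `L_m^{-1}`. -/
def domKernel (κ : ℝ) (x y : ℝ × ℝ) : ℝ :=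
  √(y.1 / x.1) * decayProfile κ (xiSq x.1 y.1 x.2 y.2) *
    ((√((x.1 - y.1) ^ 2 + (x.2 - y.2) ^ 2))⁻¹ + x.1⁻¹)

lemma measurable_domKernel (κ : ℝ) : Measurable (Function.uncurry (domKernel κ)) := by
  unfold domKernel Function.uncurry decayProfile xiSq
  fun_prop

lemma domKernel_le {κ : ℝ} (hκ0 : 0 < κ) (hκ : κ < 1/2) {x y : ℝ × ℝ} (hx : 0 < x.1)
    (hy : 0 < y.1) (hxy : 0 < (x.1 - y.1) ^ 2 + (x.2 - y.2) ^ 2) :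
    domKernel κ x y ≤ 256 * (x.1 ^ 2 * y.1 ^ 4 * max x.1 y.1 ^ (2 * κ - 6)) *
      ((x.1 - y.1) ^ 2 + (x.2 - y.2) ^ 2) ^ (-(1 + 2 * κ) / 2) := by
  obtain ⟨r, z⟩ := x
  obtain ⟨t, w⟩ := y
  simp only [domKernel, xiSq] at *
  set Q := (r - t) ^ 2 + (z - w) ^ 2 with hQ
  set ρ := √Q with hρ
  have hρ0 : 0 < ρ := sqrt_pos.2 hxy
  have hQρ : Q = ρ ^ 2 := (sq_sqrt hxy.le).symm
  have hQe : ∀ e : ℝ, Q ^ e = ρ ^ (2 * e) := fun e => by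
    rw [hQρ, ← rpow_natCast, ← rpow_mul hρ0.le]; norm_num
  have hsρ : ∀ e : ℝ, (Q / (r * t)) ^ (-e) = (r * t) ^ e * ρ ^ (-(2 * e)) := fun e => by
    rw [div_rpow hxy.le (by positivity), hQe, rpow_neg (by positivity) e, div_inv_eq_mul, mul_comm]
    ring_nf
  have hR : 0 < max r t := lt_max_of_lt_left hx
  have hrR : r ≤ max r t := le_max_left _ _
  have htR : t ≤ max r t := le_max_right _ _
  rw [hQe, show 2 * (-(1 + 2 * κ) / 2) = -(2 * κ) - 1 by ring]
  have hdp : 0 ≤ decayProfile κ (Q / (r * t)) := by unfold decayProfile; positivity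
  rcases le_total (max r t / 2) ρ with hcase | hcase
  · have h1 : ρ⁻¹ + r⁻¹ ≤ 3 * r⁻¹ := by
      have : ρ⁻¹ ≤ (r / 2)⁻¹ := by gcongr; linarith
      rw [inv_div] at this
      have h2 : 2 / r = 2 * r⁻¹ := div_eq_mul_inv _ _
      linarith
    have h2 : decayProfile κ (Q / (r * t)) ≤ (r * t) ^ (7/2:ℝ) * ρ ^ (-7:ℝ) := by
      refine (min_le_right _ _).trans_eq ?_
      rw [hsρ]; norm_num
    have h3 : √(t / r) * (r * t) ^ (7/2:ℝ) * r⁻¹ = r ^ 2 * t ^ 4 := by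
      rw [sqrt_eq_rpow, div_rpow hy.le hx.le, mul_rpow hx.le hy.le, ← rpow_neg_one r,
        ← rpow_natCast, ← rpow_natCast t, div_eq_mul_inv, ← rpow_neg hx.le]
      calc _ = (r ^ (-(1/2):ℝ) * r ^ (7/2:ℝ) * r ^ (-1:ℝ)) * (t ^ (1/2:ℝ) * t ^ (7/2:ℝ)) := by ring
        _ = _ := by
          rw [← rpow_add hx, ← rpow_add hx, ← rpow_add hy]; norm_num
    have h4 : ρ ^ (-7:ℝ) ≤ 64 * max r t ^ (2 * κ - 6) * ρ ^ (-(2 * κ) - 1) := by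
      have e1 : ρ ^ (-7:ℝ) = ρ ^ (2 * κ - 6) * ρ ^ (-(2 * κ) - 1) := by
        rw [← rpow_add hρ0]; ring_nf
      have e2 : ρ ^ (2 * κ - 6) ≤ (max r t / 2) ^ (2 * κ - 6) :=
        rpow_le_rpow_of_nonpos (by positivity) hcase (by linarith)
      have e3 : (max r t / 2) ^ (2 * κ - 6) ≤ 64 * max r t ^ (2 * κ - 6) := by
        rw [div_rpow hR.le (by norm_num), div_le_iff₀ (by positivity)]
        have e4 : (1:ℝ) ≤ 64 * 2 ^ (2 * κ - 6) := by
          have e5 : (2:ℝ) ^ (-6:ℝ) ≤ 2 ^ (2 * κ - 6) :=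
            rpow_le_rpow_of_exponent_le (by norm_num) (by linarith)
          rw [rpow_neg (by norm_num)] at e5
          norm_num at e5
          linarith
        have e6 : 0 < max r t ^ (2 * κ - 6) := by positivity
        nlinarith
      rw [e1]
      gcongr
      exact e2.trans e3
    calc √(t / r) * decayProfile κ (Q / (r * t)) * (ρ⁻¹ + r⁻¹)
        ≤ √(t / r) * ((r * t) ^ (7/2:ℝ) *
            (64 * max r t ^ (2 * κ - 6) * ρ ^ (-(2 * κ) - 1))) * (3 * r⁻¹) := by
          gcongr
          exact h2.trans (by gcongr)
      _ = 192 * (√(t / r) * (r * t) ^ (7/2:ℝ) * r⁻¹) *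
            (max r t ^ (2 * κ - 6) * ρ ^ (-(2 * κ) - 1)) := by ring
      _ ≤ 256 * (r ^ 2 * t ^ 4) * (max r t ^ (2 * κ - 6) * ρ ^ (-(2 * κ) - 1)) := by
          rw [h3]; gcongr; norm_num
      _ = _ := by ring
  · have hab : |r - t| ≤ max r t / 2 := by
      refine le_trans ?_ hcase
      rw [hρ]
      exact abs_le_sqrt (by rw [hQ]; nlinarith [sq_nonneg (z - w)])
    have hab' := abs_le.1 hab
    have hr2 : max r t / 2 ≤ r := by
      rcases max_cases r t with h | h <;> rw [h.1] at hab' ⊢ <;> linarith [hab'.1, hab'.2]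
    have ht2 : max r t / 2 ≤ t := by
      rcases max_cases r t with h | h <;> rw [h.1] at hab' ⊢ <;> linarith [hab'.1, hab'.2]
    have h1 : ρ⁻¹ + r⁻¹ ≤ 2 * ρ⁻¹ := by
      have : r⁻¹ ≤ ρ⁻¹ := by gcongr; linarith
      linarith
    have h2 : decayProfile κ (Q / (r * t)) ≤ max r t ^ (2 * κ) * ρ ^ (-(2 * κ)) := by
      refine (min_le_left _ _).trans ?_
      rw [hsρ, mul_comm 2 κ, mul_comm κ 2]
      gcongr
      calc (r * t) ^ κ ≤ (max r t * max r t) ^ κ := by gcongr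
        _ = _ := by rw [← pow_two, ← rpow_natCast, ← rpow_mul hR.le]; norm_num
    have h3 : √(t / r) ≤ 2 := by
      rw [sqrt_le_left (by norm_num), div_le_iff₀ hx]; linarith
    have h4 : max r t ^ (2 * κ) ≤ 64 * (r ^ 2 * t ^ 4 * max r t ^ (2 * κ - 6)) := by
      have e1 : max r t ^ (2 * κ) = max r t ^ 6 * max r t ^ (2 * κ - 6) := by
        rw [← rpow_natCast, ← rpow_add hR]; norm_num
      have e2 : (max r t / 2) ^ 2 * (max r t / 2) ^ 4 ≤ r ^ 2 * t ^ 4 := by gcongr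
      have e3 : max r t ^ 6 ≤ 64 * (r ^ 2 * t ^ 4) := by nlinarith
      rw [e1, ← mul_assoc 64]
      gcongr
    calc √(t / r) * decayProfile κ (Q / (r * t)) * (ρ⁻¹ + r⁻¹)
        ≤ 2 * (64 * (r ^ 2 * t ^ 4 * max r t ^ (2 * κ - 6)) * ρ ^ (-(2 * κ))) * (2 * ρ⁻¹) := by
          gcongr
          exact h2.trans (by gcongr)
      _ = 256 * (r ^ 2 * t ^ 4 * max r t ^ (2 * κ - 6)) * ρ ^ (-(2 * κ) - 1) := by
          rw [rpow_sub_one hρ0.ne']; ring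

section
variable {κ σ A B : ℝ}

lemma domKernel_nonneg {x y : ℝ × ℝ} (hx : 0 < x.1) (hy : 0 < y.1) : 0 ≤ domKernel κ x y := by
  unfold domKernel decayProfile xiSq
  positivity

lemma ofReal_domKernel_rpow_le (hκ0 : 0 < κ) (hκ : κ < 1/2) (hσ : 0 < σ) {r t : ℝ}
    (hr : 0 < r) (ht : 0 < t) (hrt : r ≠ t) (z w : ℝ) :
    ENNReal.ofReal (r ^ A * domKernel κ (r, z) (t, w) * t ^ B) ^ σ ≤
      ENNReal.ofReal (256 ^ σ * (r ^ ((A + 2) * σ) * t ^ ((B + 4) * σ) *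
        max r t ^ ((2 * κ - 6) * σ))) *
      ENNReal.ofReal ((|r - t| ^ 2 + (w - z) ^ 2) ^ (-((1 + 2 * κ) * σ) / 2)) := by
  have hQ : 0 < (r - t) ^ 2 + (z - w) ^ 2 := by
    have := sq_pos_of_ne_zero (sub_ne_zero.2 hrt); positivity
  have h := domKernel_le hκ0 hκ (x := (r, z)) (y := (t, w)) hr ht hQ
  have h0 := domKernel_nonneg (κ := κ) (x := (r, z)) (y := (t, w)) hr ht
  have hR : 0 < max r t := lt_max_of_lt_left hr
  rw [ENNReal.ofReal_rpow_of_nonneg (by positivity) hσ.le, ← ENNReal.ofReal_mul (by positivity)]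
  refine ENNReal.ofReal_le_ofReal ?_
  rw [sq_abs, show (w - z) ^ 2 = (z - w) ^ 2 by ring]
  simp only at h
  calc (r ^ A * domKernel κ (r, z) (t, w) * t ^ B) ^ σ
      ≤ (r ^ A * (256 * (r ^ 2 * t ^ 4 * max r t ^ (2 * κ - 6)) *
          ((r - t) ^ 2 + (z - w) ^ 2) ^ (-(1 + 2 * κ) / 2)) * t ^ B) ^ σ := by gcongr
    _ = (256 * (r ^ (A + 2) * t ^ (B + 4) * max r t ^ (2 * κ - 6)) *
          ((r - t) ^ 2 + (z - w) ^ 2) ^ (-(1 + 2 * κ) / 2)) ^ σ := by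
        rw [rpow_add hr, rpow_add ht]
        congr 1
        have e1 : r ^ (2:ℝ) = r ^ 2 := rpow_two r
        have e2 : t ^ (4:ℝ) = t ^ 4 := by rw [← rpow_natCast]; norm_num
        rw [e1, e2]; ring
    _ = _ := by
        rw [mul_rpow (by positivity) (by positivity), mul_rpow (by positivity) (by positivity),
          mul_rpow (by positivity) (by positivity), mul_rpow (by positivity) (by positivity),
          ← rpow_mul hr.le, ← rpow_mul ht.le, ← rpow_mul hR.le, ← rpow_mul hQ.le]
        congr 2; ring

lemma exists_lintegral_domKernel_le (hκ0 : 0 < κ) (hκ : κ < 1/2) (hσ : 0 < σ)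
    (hμ : 1 < (1 + 2 * κ) * σ) (hAB : (A + B) * σ = σ - 1) :
    ∃ C : ℝ, 0 ≤ C ∧ ∀ r t : ℝ, 0 < r → 0 < t → r ≠ t →
      (∀ z, ∫⁻ w, ENNReal.ofReal (r ^ A * domKernel κ (r, z) (t, w) * t ^ B) ^ σ ≤
        ENNReal.ofReal (C * radialKernel ((A + 2) * σ) ((B + 4) * σ) ((1 + 2 * κ) * σ - 1) r t)) ∧
      (∀ w, ∫⁻ z, ENNReal.ofReal (r ^ A * domKernel κ (r, z) (t, w) * t ^ B) ^ σ ≤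
        ENNReal.ofReal
          (C * radialKernel ((A + 2) * σ) ((B + 4) * σ) ((1 + 2 * κ) * σ - 1) r t)) := by
  obtain ⟨C, hC0, hC⟩ := exists_lintegral_sq_add_sq_rpow_le hμ
  refine ⟨256 ^ σ * C, by positivity, fun r t hr ht hrt => ?_⟩
  have ha : 0 < |r - t| := abs_pos.2 (sub_ne_zero.2 hrt)
  have hR : 0 < max r t := lt_max_of_lt_left hr
  have hcalc : ENNReal.ofReal (256 ^ σ * (r ^ ((A + 2) * σ) * t ^ ((B + 4) * σ) *
        max r t ^ ((2 * κ - 6) * σ))) * ENNReal.ofReal (C * |r - t| ^ (1 - (1 + 2 * κ) * σ)) =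
      ENNReal.ofReal (256 ^ σ * C *
        radialKernel ((A + 2) * σ) ((B + 4) * σ) ((1 + 2 * κ) * σ - 1) r t) := by
    rw [← ENNReal.ofReal_mul (by positivity), radialKernel,
      show (1 + 2 * κ) * σ - 1 - (A + 2) * σ - (B + 4) * σ = (2 * κ - 6) * σ by linarith,
      show -((1 + 2 * κ) * σ - 1) = 1 - (1 + 2 * κ) * σ by ring]
    congr 1; ring
  rw [← hcalc]
  constructor
  · intro z
    refine (lintegral_mono fun w => ofReal_domKernel_rpow_le hκ0 hκ hσ hr ht hrt z w).trans ?_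
    rw [lintegral_const_mul' _ _ ENNReal.ofReal_ne_top]
    gcongr
    exact hC _ ha z
  · intro w
    refine (lintegral_mono fun z => ofReal_domKernel_rpow_le hκ0 hκ hσ hr ht hrt z w).trans ?_
    rw [lintegral_const_mul' _ _ ENNReal.ofReal_ne_top]
    gcongr
    simp_rw [show ∀ z : ℝ, (w - z) ^ 2 = (z - w) ^ 2 from fun z => by ring]
    exact hC _ ha w

end

/-- The integral operator with kernel `domKernel`. -/
def domPotential (κ : ℝ) (G : ℝ × ℝ → ℝ≥0∞) (x : ℝ × ℝ) : ℝ≥0∞ :=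
  ∫⁻ y, ENNReal.ofReal (domKernel κ x y) * G y ∂halfPlane

lemma measurable_domPotential (κ : ℝ) {G : ℝ × ℝ → ℝ≥0∞} (hG : Measurable G) :
    Measurable (domPotential κ G) := by
  have : Measurable (Function.uncurry fun x y => ENNReal.ofReal (domKernel κ x y) * G y) :=
    (measurable_domKernel κ).ennreal_ofReal.mul (hG.comp measurable_snd)
  exact this.lintegral_prod_right'

lemma exists_lintegral_domPotential_le {p q α β κ : ℝ} (hq1 : 1 < q) (hqp : q < p)
    (hα : -2 ≤ α + 1/p) (hβ : -3 ≤ β - 1/q)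
    (hscal : 1/q = 1/p + (α + β)/3) (hκ0 : 0 < κ) (hκ : κ < 1/2 + 1/p - 1/q) :
    ∃ C : ℝ≥0∞, C ≠ ∞ ∧ ∀ G : ℝ × ℝ → ℝ≥0∞, Measurable G →
      ∫⁻ x, ENNReal.ofReal (x.1 ^ (α * p + 1)) * domPotential κ G x ^ p ∂halfPlane ≤
        C * (∫⁻ y, ENNReal.ofReal (y.1 ^ ((1 - β) * q + 1)) * G y ^ q ∂halfPlane) ^ (p / q) := by
  have hq0 : 0 < q := by linarith
  have hp0 : 0 < p := by linarith
  have hpq : 1/p < 1/q := one_div_lt_one_div_of_lt hq0 hqp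
  have hp' : 0 < 1/p := by positivity
  have hq' : 1/q < 1 := by rw [div_lt_one hq0]; exact hq1
  set σ : ℝ := 1 / (1 + 1/p - 1/q) with hσdef
  have hσi : 0 < 1 + 1/p - 1/q := by linarith
  have hσ : 0 < σ := by positivity
  have h1σ : 1 / σ = 1 + 1/p - 1/q := by rw [hσdef, one_div_one_div]
  have hσmul : σ * (1 + 1/p - 1/q) = 1 := by rw [hσdef, one_div_mul_cancel hσi.ne']
  have hκ2 : κ < 1/2 := by linarith
  set A : ℝ := α + 2/p with hA
  set B : ℝ := β - 2/q with hB
  have e2p : 2/p = 1/p + 1/p := by ring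
  have e2q : 2/q = 1/q + 1/q := by ring
  have hAB : (A + B) * σ = σ - 1 := by
    have : A + B = 1 - (1 + 1/p - 1/q) := by rw [hA, hB, e2p, e2q]; linarith
    rw [this, sub_mul, mul_comm _ σ, mul_comm _ σ, hσmul, mul_one]
  have hμ : 1 < (1 + 2 * κ) * σ := by nlinarith
  have hν1 : (1 + 2 * κ) * σ - 1 < 1 := by nlinarith
  have ha : 0 < (A + 2) * σ := mul_pos (by rw [hA, e2p]; linarith) hσ
  have hb : 0 < (B + 4) * σ := mul_pos (by rw [hB, e2q]; linarith) hσ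
  obtain ⟨C1, hC10, hC1⟩ := exists_lintegral_domKernel_le (A := A) (B := B) hκ0 hκ2 hσ hμ hAB
  obtain ⟨C2, hC2t, hC2⟩ := exists_lintegral_radialKernel_le ha hb (sub_pos.2 hμ) hν1
  obtain ⟨C3, hC3t, hC3⟩ := exists_lintegral_radialKernel_le hb ha (sub_pos.2 hμ) hν1
  set ν : Measure (ℝ × ℝ) := halfPlane.withDensity fun x => ENNReal.ofReal x.1⁻¹ with hν
  have hdens : Measurable fun x : ℝ × ℝ => ENNReal.ofReal x.1⁻¹ := by fun_prop
  have hνint : ∀ F : ℝ × ℝ → ℝ≥0∞, Measurable F →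
      ∫⁻ x, F x ∂ν = ∫⁻ x, ENNReal.ofReal x.1⁻¹ * F x ∂halfPlane := fun F hF =>
    lintegral_withDensity_eq_lintegral_mul _ hdens hF
  have hνae : ∀ᵐ x ∂ν, 0 < x.1 := (withDensity_absolutelyContinuous _ _) ae_halfPlane_pos
  set K : ℝ × ℝ → ℝ × ℝ → ℝ≥0∞ :=
    fun x y => ENNReal.ofReal (x.1 ^ A * domKernel κ x y * y.1 ^ B) with hK
  have hKm : Measurable (Function.uncurry K) := by
    have := measurable_domKernel κ
    have h2 : Measurable fun u : (ℝ × ℝ) × (ℝ × ℝ) =>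
        u.1.1 ^ A * Function.uncurry (domKernel κ) u * u.2.1 ^ B := by fun_prop
    exact h2.ennreal_ofReal
  set D : ℝ≥0∞ := ENNReal.ofReal C1 * max C2 C3 with hD
  have hDt : D ≠ ∞ := ENNReal.mul_ne_top ENNReal.ofReal_ne_top (max_lt hC2t.lt_top hC3t.lt_top).ne
  have hne : ∀ r : ℝ, ∀ᵐ t ∂(volume.restrict (Ioi (0:ℝ))), t ≠ r := fun r =>
    Measure.ae_ne _ r
  have hA1 : ∀ᵐ x ∂ν, ∫⁻ y, K x y ^ σ ∂ν ≤ D := by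
    filter_upwards [hνae] with x hx
    have hm1 : Measurable fun y => K x y ^ σ := (hKm.comp measurable_prodMk_left).pow_const σ
    have hm2 : Measurable fun y : ℝ × ℝ => ENNReal.ofReal y.1⁻¹ * K x y ^ σ := hdens.mul hm1
    rw [hνint _ hm1, lintegral_halfPlane hm2]
    calc _ ≤ ∫⁻ t in Ioi 0, ENNReal.ofReal C1 * ENNReal.ofReal (radialKernel ((A + 2) * σ)
            ((B + 4) * σ) ((1 + 2 * κ) * σ - 1) x.1 t * t⁻¹) := by
          refine lintegral_mono_ae ?_
          filter_upwards [hne x.1, ae_restrict_mem measurableSet_Ioi] with t htx ht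
          have ht0 : 0 < t := ht
          rw [lintegral_const_mul' _ _ ENNReal.ofReal_ne_top]
          refine (mul_le_mul_right ((hC1 x.1 t hx ht0 htx.symm).1 x.2) _).trans_eq ?_
          rw [← ENNReal.ofReal_mul (by positivity), ← ENNReal.ofReal_mul hC10]
          congr 1; ring
      _ ≤ _ := by
          rw [lintegral_const_mul' _ _ ENNReal.ofReal_ne_top, hD]
          gcongr
          exact (hC2 _ hx).trans (le_max_left _ _)
  have hA2 : ∀ᵐ y ∂ν, ∫⁻ x, K x y ^ σ ∂ν ≤ D := by
    filter_upwards [hνae] with y hy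
    have hm1 : Measurable fun x => K x y ^ σ := (hKm.comp measurable_prodMk_right).pow_const σ
    have hm2 : Measurable fun x : ℝ × ℝ => ENNReal.ofReal x.1⁻¹ * K x y ^ σ := hdens.mul hm1
    rw [hνint _ hm1, lintegral_halfPlane hm2]
    calc _ ≤ ∫⁻ r in Ioi 0, ENNReal.ofReal C1 * ENNReal.ofReal (radialKernel ((B + 4) * σ)
            ((A + 2) * σ) ((1 + 2 * κ) * σ - 1) y.1 r * r⁻¹) := by
          refine lintegral_mono_ae ?_
          filter_upwards [hne y.1, ae_restrict_mem measurableSet_Ioi] with r hry hr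
          have hr0 : 0 < r := hr
          rw [lintegral_const_mul' _ _ ENNReal.ofReal_ne_top]
          refine (mul_le_mul_right ((hC1 r y.1 hr0 hy hry).2 y.2) _).trans_eq ?_
          rw [← ENNReal.ofReal_mul (by positivity), ← ENNReal.ofReal_mul hC10, radialKernel_symm]
          congr 1; ring
      _ ≤ _ := by
          rw [lintegral_const_mul' _ _ ENNReal.ofReal_ne_top, hD]
          gcongr
          exact (hC3 _ hy).trans (le_max_right _ _)
  refine ⟨D ^ (p / σ), ENNReal.rpow_ne_top_of_nonneg (by positivity) hDt, fun G hG => ?_⟩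
  set h : ℝ × ℝ → ℝ≥0∞ := fun y => ENNReal.ofReal (y.1 ^ (1 - B)) * G y with hh
  have hhm : Measurable h := by
    have : Measurable fun y : ℝ × ℝ => y.1 ^ (1 - B) := by fun_prop
    exact this.ennreal_ofReal.mul hG
  have young := lintegral_rpow_kernel_le (μ := ν) (ν := ν) hq1 hqp hσ h1σ hKm hhm hA1 hA2
  have hKh : ∀ x : ℝ × ℝ, 0 < x.1 →
      ∫⁻ y, K x y * h y ∂ν = ENNReal.ofReal (x.1 ^ A) * domPotential κ G x := fun x hx => by
    have hm : Measurable fun y => K x y * h y := (hKm.comp measurable_prodMk_left).mul hhm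
    rw [hνint _ hm, domPotential,
      ← lintegral_const_mul' _ _ ENNReal.ofReal_ne_top]
    refine lintegral_congr_ae ?_
    filter_upwards [ae_halfPlane_pos] with y hy
    have h0 := domKernel_nonneg (κ := κ) hx hy
    simp only [hK, hh]
    rw [← mul_assoc, ← mul_assoc, ← mul_assoc, ← ENNReal.ofReal_mul (by positivity),
      ← ENNReal.ofReal_mul (by positivity), ← ENNReal.ofReal_mul (by positivity)]
    congr 2
    have e : y.1 ^ B * y.1 ^ (1 - B) = y.1 := by rw [← rpow_add hy]; simp
    calc y.1⁻¹ * (x.1 ^ A * domKernel κ x y * y.1 ^ B) * y.1 ^ (1 - B)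
        = y.1⁻¹ * (x.1 ^ A * domKernel κ x y) * (y.1 ^ B * y.1 ^ (1 - B)) := by ring
      _ = _ := by rw [e]; field_simp
  have hMm := measurable_domPotential κ hG
  have hleft : ∫⁻ x, (∫⁻ y, K x y * h y ∂ν) ^ p ∂ν =
      ∫⁻ x, ENNReal.ofReal (x.1 ^ (α * p + 1)) * domPotential κ G x ^ p ∂halfPlane := by
    have hm : Measurable fun x => ∫⁻ y, K x y * h y ∂ν := by
      have : Measurable (Function.uncurry fun x y => K x y * h y) :=
        hKm.mul (hhm.comp measurable_snd)
      exact this.lintegral_prod_right'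
    rw [hνint _ (hm.pow_const p)]
    refine lintegral_congr_ae ?_
    filter_upwards [ae_halfPlane_pos] with x hx
    rw [hKh x hx, ENNReal.mul_rpow_of_nonneg _ _ hp0.le, ENNReal.ofReal_rpow_of_pos (by positivity),
      ← mul_assoc, ← ENNReal.ofReal_mul (by positivity), ← rpow_mul hx.le, ← rpow_neg_one,
      ← rpow_add hx]
    congr 3
    rw [hA]; field_simp; ring
  have hright : ∫⁻ y, h y ^ q ∂ν =
      ∫⁻ y, ENNReal.ofReal (y.1 ^ ((1 - β) * q + 1)) * G y ^ q ∂halfPlane := by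
    rw [hνint _ (hhm.pow_const q)]
    refine lintegral_congr_ae ?_
    filter_upwards [ae_halfPlane_pos] with y hy
    rw [hh, ENNReal.mul_rpow_of_nonneg _ _ hq0.le, ENNReal.ofReal_rpow_of_pos (by positivity),
      ← mul_assoc, ← ENNReal.ofReal_mul (by positivity), ← rpow_mul hy.le, ← rpow_neg_one,
      ← rpow_add hy]
    congr 3
    rw [hB]; field_simp; ring
  rw [← hleft, ← hright]
  exact young

/-- The kernel of `2π L_m^{-1}` with respect to Lebesgue measure on the half-plane. -/
def greenKernel (m : ℕ) (x y : ℝ × ℝ) : ℝ :=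
  Fm m (xiSq x.1 y.1 x.2 y.2) * √(y.1 / x.1)

lemma contDiffOn_Fm (m : ℕ) : ContDiffOn ℝ 1 (Fm m) (Ioi 0) := by
  rw [show (1 : WithTop ℕ∞) = 0 + 1 from rfl, contDiffOn_succ_iff_deriv_of_isOpen isOpen_Ioi]
  refine ⟨fun s hs => (hasDerivAt_Fm m hs).differentiableAt.differentiableWithinAt, by simp, ?_⟩
  rw [contDiffOn_zero]
  exact (continuousOn_const.mul (continuousOn_sinPowIntegral m (by positivity))).congr
    fun s hs => (hasDerivAt_Fm m hs).deriv

section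
variable {κ M r z t w d1 d2 : ℝ} {m : ℕ}

lemma exists_hasDerivAt_greenKernel (hr : 0 < r) (ht : 0 < t)
    (hQ : 0 < (r - t) ^ 2 + (z - w) ^ 2) (hd1 : 0 ≤ d1) (hd2 : 0 ≤ d2)
    (hM : ∀ s : ℝ, 0 < s → |Fm m s| ≤ M * decayProfile κ s ∧
      s * |deriv (Fm m) s| ≤ M * decayProfile κ s) {ρ ζ : ℝ → ℝ} {u : ℝ}
    (hρ : HasDerivAt ρ d1 u) (hζ : HasDerivAt ζ d2 u) (hρu : ρ u = r) (hζu : ζ u = z) :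
    ∃ D, HasDerivAt (fun v => greenKernel m (ρ v, ζ v) (t, w)) D u ∧
      |D| ≤ 2 * M * (d1 + d2) * domKernel κ (r, z) (t, w) := by
  have hrt : r * t ≠ 0 := by positivity
  set Q := (r - t) ^ 2 + (z - w) ^ 2 with hQdef
  set s := Q / (r * t) with hs
  have hs0 : 0 < s := by positivity
  set S := √(t / r) with hS
  have hS0 : 0 < S := sqrt_pos.2 (by positivity)
  have hxi : HasDerivAt (fun v => xiSq (ρ v) t (ζ v) w)
      (s * ((2 * (r - t) * d1 + 2 * (z - w) * d2) / Q - d1 / r)) u := by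
    have h := ((((hρ.sub_const t).pow 2).add ((hζ.sub_const w).pow 2)).div (hρ.mul_const t)
      (by rw [hρu]; exact hrt))
    refine h.congr_deriv ?_
    simp only [Pi.add_apply, Pi.pow_apply, hρu, hζu, ← hQdef]
    rw [hs]
    field_simp
    push_cast
    ring
  have hxiu : xiSq (ρ u) t (ζ u) w = s := by simp only [xiSq, hρu, hζu, hs, hQdef]
  have hF : HasDerivAt (Fm m) (deriv (Fm m) s) (xiSq (ρ u) t (ζ u) w) := by
    rw [hxiu]; exact (hasDerivAt_Fm m hs0).differentiableAt.hasDerivAt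
  have hsq : HasDerivAt (fun v => √(t / ρ v)) (-(S * (d1 / (2 * r)))) u := by
    have h := (((hasDerivAt_const u t).div hρ (by rw [hρu]; exact hr.ne'))).sqrt
      (by simp only [Pi.div_apply, hρu]; positivity)
    refine h.congr_deriv ?_
    simp only [Pi.div_apply, hρu, ← hS]
    have : S ^ 2 = t / r := sq_sqrt (by positivity)
    have ht' : t = S ^ 2 * r := by rw [this]; field_simp
    rw [ht']
    field_simp
    ring
  have hFc := HasDerivAt.comp (h₂ := Fm m) u hF hxi
  have hD : HasDerivAt (fun v => greenKernel m (ρ v, ζ v) (t, w)) _ u := hFc.mul hsq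
  refine ⟨_, hD, ?_⟩
  rw [Function.comp_apply, hxiu, hρu, ← hS]
  obtain ⟨hM1, hM2⟩ := hM s hs0
  set Φ := decayProfile κ s with hΦ
  set P := √Q with hP
  have hP0 : 0 < P := sqrt_pos.2 hQ
  have hPQ : Q = P ^ 2 := (sq_sqrt hQ.le).symm
  have hMΦ : 0 ≤ M * Φ := (abs_nonneg _).trans hM1
  have h1 : |r - t| ≤ P := abs_le_sqrt (by rw [hQdef]; nlinarith [sq_nonneg (z - w)])
  have h2 : |z - w| ≤ P := abs_le_sqrt (by rw [hQdef]; nlinarith [sq_nonneg (r - t)])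
  have h3 : |(2 * (r - t) * d1 + 2 * (z - w) * d2) / Q - d1 / r| ≤
      2 * (d1 + d2) * P⁻¹ + d1 * r⁻¹ := by
    refine (abs_sub _ _).trans ?_
    rw [abs_div, abs_of_pos hQ, abs_of_nonneg (show 0 ≤ d1 / r by positivity), ← div_eq_mul_inv d1]
    gcongr
    rw [div_le_iff₀ hQ]
    calc |2 * (r - t) * d1 + 2 * (z - w) * d2|
        ≤ |2 * (r - t) * d1| + |2 * (z - w) * d2| := abs_add_le _ _
      _ = 2 * |r - t| * d1 + 2 * |z - w| * d2 := by
          simp only [abs_mul, abs_of_nonneg hd1, abs_of_nonneg hd2, abs_two]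
      _ ≤ 2 * P * d1 + 2 * P * d2 := by gcongr
      _ = _ := by rw [hPQ]; field_simp
  calc _ ≤ |deriv (Fm m) s * (s * ((2 * (r - t) * d1 + 2 * (z - w) * d2) / Q - d1 / r)) * S| +
        |Fm m s * -(S * (d1 / (2 * r)))| := abs_add_le _ _
    _ = s * |deriv (Fm m) s| * |(2 * (r - t) * d1 + 2 * (z - w) * d2) / Q - d1 / r| * S +
        |Fm m s| * (S * (d1 / (2 * r))) := by
        rw [abs_mul, abs_mul, abs_mul, abs_mul, abs_neg, abs_of_pos hs0, abs_of_pos hS0,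
          abs_of_nonneg (show 0 ≤ S * (d1 / (2 * r)) by positivity)]
        ring
    _ ≤ M * Φ * (2 * (d1 + d2) * P⁻¹ + d1 * r⁻¹) * S + M * Φ * (S * (d1 / (2 * r))) := by
        gcongr
    _ ≤ M * Φ * (2 * (d1 + d2) * (P⁻¹ + r⁻¹)) * S := by
        have : 2 * (d1 + d2) * P⁻¹ + d1 * r⁻¹ + d1 / (2 * r) ≤ 2 * (d1 + d2) * (P⁻¹ + r⁻¹) := by
          have e : d1 / (2 * r) = d1 * r⁻¹ / 2 := by field_simp
          have e1 : 0 ≤ d1 * r⁻¹ := by positivity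
          have e2 : 0 ≤ d2 * r⁻¹ := by positivity
          rw [e]; nlinarith
        calc _ = M * Φ * (2 * (d1 + d2) * P⁻¹ + d1 * r⁻¹ + d1 / (2 * r)) * S := by ring
          _ ≤ _ := by gcongr
    _ = _ := by
        change _ = 2 * M * (d1 + d2) * (S * Φ * (P⁻¹ + r⁻¹))
        ring

lemma enorm_greenKernel_sub_le (hr : 0 < r) (ht : 0 < t) (hd1 : 0 ≤ d1) (hd2 : 0 ≤ d2)
    (hQ : ∀ u ∈ Icc (0:ℝ) 1, 0 < (r + u * d1 - t) ^ 2 + (z + u * d2 - w) ^ 2)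
    (hM : ∀ s : ℝ, 0 < s → |Fm m s| ≤ M * decayProfile κ s ∧
      s * |deriv (Fm m) s| ≤ M * decayProfile κ s) (hM0 : 0 ≤ M) :
    ‖greenKernel m (r + d1, z + d2) (t, w) - greenKernel m (r, z) (t, w)‖ₑ ≤
      ENNReal.ofReal (2 * M * (d1 + d2)) *
        ∫⁻ u in Icc (0:ℝ) 1, ENNReal.ofReal (domKernel κ (r + u * d1, z + u * d2) (t, w)) := by
  have hpos : ∀ u ∈ Icc (0:ℝ) 1, 0 < r + u * d1 := fun u hu => by
    have := mul_nonneg hu.1 hd1; linarith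
  have hcd : ContDiffOn ℝ 1 (fun u => greenKernel m (r + u * d1, z + u * d2) (t, w))
      (Icc 0 1) := by
    unfold greenKernel xiSq
    refine ContDiffOn.mul ?_ ?_
    · refine (contDiffOn_Fm m).comp (ContDiffOn.div (by fun_prop) (by fun_prop) fun u hu => ?_)
        fun u hu => ?_
      · have := hpos u hu; positivity
      · have := hpos u hu
        have := hQ u hu
        rw [mem_Ioi]
        positivity
    · refine ContDiffOn.sqrt (ContDiffOn.div (by fun_prop) (by fun_prop) fun u hu => ?_)
        fun u hu => ?_
      · exact (hpos u hu).ne'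
      · have := hpos u hu
        positivity
  have h := enorm_sub_le_lintegral_deriv_of_contDiffOn_Icc hcd zero_le_one
  simp only [one_mul, zero_mul, add_zero] at h
  refine h.trans ?_
  rw [← lintegral_const_mul' _ _ ENNReal.ofReal_ne_top]
  refine setLIntegral_mono' measurableSet_Icc fun u hu => ?_
  have hu0 := hpos u hu
  obtain ⟨D, hD, hDle⟩ := exists_hasDerivAt_greenKernel (m := m) (u := u)
    (ρ := fun u => r + u * d1) (ζ := fun u => z + u * d2) hu0 ht (hQ u hu) hd1 hd2 hM
    (by simpa using ((hasDerivAt_id u).mul_const d1).const_add r)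
    (by simpa using ((hasDerivAt_id u).mul_const d2).const_add z) rfl rfl
  rw [hD.deriv, ← ENNReal.ofReal_mul (by positivity), ← ofReal_norm]
  exact ENNReal.ofReal_le_ofReal hDle

end

lemma measurable_Fm (m : ℕ) : Measurable (Fm m) := by
  have h : Measurable (Function.uncurry fun s θ : ℝ =>
      Real.cos (m * θ) / √(s + 2 * (1 - Real.cos θ))) := by
    unfold Function.uncurry
    fun_prop
  have h2 := h.stronglyMeasurable.integral_prod_right (ν := volume.restrict (Ioc 0 Real.pi))
  have h3 : Fm m = fun s => ∫ θ in Ioc 0 Real.pi, Real.cos (m * θ) / √(s + 2 * (1 - Real.cos θ)) :=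
    funext fun s => intervalIntegral.integral_of_le Real.pi_pos.le
  rw [h3]
  exact h2.measurable

lemma measurable_greenKernel (m : ℕ) : Measurable (Function.uncurry (greenKernel m)) := by
  have := measurable_Fm m
  unfold greenKernel Function.uncurry xiSq
  fun_prop

lemma ae_halfPlane_ne (r z : ℝ) : ∀ᵐ y ∂halfPlane, y.1 ≠ r ∧ y.2 ≠ z := by
  have h1 : ∀ᵐ t ∂(volume.restrict (Ioi (0:ℝ))), t ≠ r := Measure.ae_ne _ r
  have h2 : ∀ᵐ t ∂(volume : Measure ℝ), t ≠ z := Measure.ae_ne _ z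
  filter_upwards [Measure.quasiMeasurePreserving_fst.ae h1,
    Measure.quasiMeasurePreserving_snd.ae h2] with y hy1 hy2 using ⟨hy1, hy2⟩

/-- `g` is measurable, bounded, and supported in a compact box in `(0,∞) × ℝ`. -/
structure BoxBounded (g : ℝ × ℝ → ℝ) : Prop where
  measurable : Measurable g
  exists_bound : ∃ B a b N : ℝ, 0 ≤ B ∧ 0 < a ∧
    ∀ y, |g y| ≤ (Icc a b ×ˢ Icc (-N) N).indicator (fun _ => B) y

lemma TestFun.boxBounded {f : ℝ → ℝ → ℝ} (hf : TestFun f) (γ : ℝ) :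
    BoxBounded fun y => y.1 ^ γ * f y.1 y.2 := by
  obtain ⟨hsm, hcs, hsupp⟩ := hf
  have hfc : Continuous fun y : ℝ × ℝ => f y.1 y.2 := hsm.continuous
  refine ⟨(measurable_fst.pow_const γ).mul hfc.measurable, ?_⟩
  set K := tsupport (Function.uncurry f) with hK
  have hKc : IsCompact K := hcs
  have hzero : ∀ y ∉ K, f y.1 y.2 = 0 := fun y hy =>
    image_eq_zero_of_notMem_tsupport (f := Function.uncurry f) hy
  have hcont : ContinuousOn (fun y : ℝ × ℝ => y.1 ^ γ * f y.1 y.2) K :=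
    (continuousOn_fst.rpow_const fun y hy => Or.inl (ne_of_gt (hsupp hy).1)).mul hfc.continuousOn
  obtain ⟨B, hB⟩ := hKc.exists_bound_of_continuousOn hcont
  obtain ⟨N, hN⟩ := hKc.exists_bound_of_continuousOn (f := Prod.snd) continuousOn_snd
  obtain ⟨b, hb⟩ := hKc.exists_bound_of_continuousOn (f := Prod.fst) continuousOn_fst
  obtain ⟨A, hA⟩ := hKc.exists_bound_of_continuousOn (f := fun y : ℝ × ℝ => y.1⁻¹)
    (continuousOn_fst.inv₀ fun y hy => ne_of_gt (hsupp hy).1)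
  refine ⟨max B 0, (max A 1)⁻¹, b, N, le_max_right _ _, by positivity, fun y => ?_⟩
  by_cases hy : y ∈ K
  · have hy0 : 0 < y.1 := (hsupp hy).1
    rw [indicator_of_mem]
    · exact (hB y hy).trans (le_max_left _ _)
    · refine ⟨⟨?_, (le_abs_self _).trans (hb y hy)⟩, abs_le.1 (hN y hy)⟩
      rw [inv_le_comm₀ (by positivity) hy0]
      exact (le_abs_self _).trans ((hA y hy).trans (le_max_left _ _))
  · rw [hzero y hy, mul_zero, abs_zero]
    exact indicator_nonneg (fun _ _ => le_max_right _ _) _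

section
variable {κ M : ℝ} {m : ℕ}

lemma integrable_greenKernel_mul (hκ0 : 0 < κ) (hκ : κ < 1/2) (hM0 : 0 ≤ M)
    (hM : ∀ s : ℝ, 0 < s → |Fm m s| ≤ M * decayProfile κ s) {g : ℝ × ℝ → ℝ} (hg : BoxBounded g)
    {r : ℝ} (hr : 0 < r) (z : ℝ) :
    Integrable (fun y => greenKernel m (r, z) y * g y) halfPlane := by
  obtain ⟨B, a, b, N, hB0, ha, hB⟩ := hg.exists_bound
  have i1 : Integrable ((Icc a b).indicator fun _ : ℝ => (1:ℝ)) (volume.restrict (Ioi 0)) :=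
    (IntegrableOn.integrable_indicator (by simp) measurableSet_Icc).restrict
  have i2 : Integrable ((Icc (-N) N).indicator fun w : ℝ => |z - w| ^ (-(2 * κ))) volume := by
    refine IntegrableOn.integrable_indicator ?_ measurableSet_Icc
    rcases le_total (-N) N with hN | hN
    · rw [← intervalIntegrable_iff_integrableOn_Icc_of_le hN]
      have := (intervalIntegrable_abs_rpow (e := -(2 * κ)) (by linarith) (z - -N)
        (z - N)).comp_sub_left z
      simpa using this
    · refine IntegrableOn.of_measure_zero ?_
      rw [Real.volume_Icc, ENNReal.ofReal_eq_zero]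
      linarith
  have i3 := (i1.mul_prod i2).const_mul (M * (r * b) ^ κ * √(b / r) * B)
  refine Integrable.mono' i3 ?_ ?_
  · exact ((measurable_greenKernel m).comp measurable_prodMk_left |>.mul
      hg.measurable).aestronglyMeasurable
  · filter_upwards [ae_halfPlane_pos, ae_halfPlane_ne r z] with y hy hyne
    have hgy := hB y
    rw [norm_mul, Real.norm_eq_abs, Real.norm_eq_abs]
    by_cases hbox : y ∈ Icc a b ×ˢ Icc (-N) N
    · rw [indicator_of_mem hbox] at hgy
      rw [indicator_of_mem hbox.1, indicator_of_mem hbox.2]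
      have hyb : y.1 ≤ b := hbox.1.2
      have hb : 0 < b := hy.trans_le hyb
      have hzw : 0 < |z - y.2| := abs_pos.2 (sub_ne_zero.2 hyne.2.symm)
      have hzw2 : 0 < (z - y.2) ^ 2 := by rw [← sq_abs]; positivity
      have hxi : |z - y.2| ^ 2 / (r * b) ≤ xiSq r y.1 z y.2 := by
        unfold xiSq
        rw [sq_abs]
        gcongr
        nlinarith [sq_nonneg (r - y.1)]
      have hxi0 : 0 < xiSq r y.1 z y.2 := lt_of_lt_of_le (by positivity) hxi
      have hF : |Fm m (xiSq r y.1 z y.2)| ≤ M * ((r * b) ^ κ * |z - y.2| ^ (-(2 * κ))) := by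
        refine (hM _ hxi0).trans ?_
        gcongr
        refine (min_le_left _ _).trans ((rpow_le_rpow_of_nonpos (by positivity) hxi
          (by linarith)).trans_eq ?_)
        rw [div_rpow (by positivity) (by positivity), ← rpow_natCast, ← rpow_mul hzw.le,
          rpow_neg (by positivity : 0 ≤ r * b), div_inv_eq_mul, mul_comm]
        norm_num
      rw [greenKernel, abs_mul, abs_of_nonneg (sqrt_nonneg _)]
      calc |Fm m (xiSq r y.1 z y.2)| * √(y.1 / r) * |g y|
          ≤ M * ((r * b) ^ κ * |z - y.2| ^ (-(2 * κ))) * √(b / r) * B := by gcongr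
        _ = _ := by ring
    · rw [indicator_of_notMem hbox] at hgy
      rw [le_antisymm hgy (abs_nonneg _), mul_zero]
      by_cases hb : 0 < b
      · exact mul_nonneg (by positivity) (mul_nonneg
          (indicator_nonneg (fun _ _ => zero_le_one) _)
          (indicator_nonneg (fun _ _ => by positivity) _))
      · rw [indicator_of_notMem (s := Icc a b), zero_mul, mul_zero]
        exact fun h => hb (hy.trans_le h.2)

lemma Lminv_eq_integral_halfPlane {g : ℝ × ℝ → ℝ} {r z : ℝ}
    (hinteg : Integrable (fun y => greenKernel m (r, z) y * g y) halfPlane) :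
    Lminv m (fun t w => g (t, w)) r z =
      1 / (2 * Real.pi) * ∫ y, greenKernel m (r, z) y * g y ∂halfPlane := by
  rw [halfPlane, integral_prod _ hinteg, Lminv]
  congr 2
  ext t
  congr 1
  ext w
  simp only [greenKernel]
  ring

lemma enorm_Lminv_sub_le (hκ0 : 0 < κ) (hκ : κ < 1/2) (hM0 : 0 ≤ M)
    (hM : ∀ s : ℝ, 0 < s → |Fm m s| ≤ M * decayProfile κ s ∧
      s * |deriv (Fm m) s| ≤ M * decayProfile κ s) {g : ℝ × ℝ → ℝ} (hg : BoxBounded g)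
    {r : ℝ} (hr : 0 < r) (z : ℝ) {d1 d2 : ℝ} (hd1 : 0 ≤ d1) (hd2 : 0 ≤ d2)
    (hd : d1 = 0 ∨ d2 = 0) :
    ‖Lminv m (fun t w => g (t, w)) (r + d1) (z + d2) - Lminv m (fun t w => g (t, w)) r z‖ₑ ≤
      ENNReal.ofReal (2 * M * (d1 + d2)) *
        ∫⁻ u in Icc (0:ℝ) 1, domPotential κ (fun y => ‖g y‖ₑ) (r + u * d1, z + u * d2) := by
  have hM' := fun s hs => (hM s hs).1
  have i1 := integrable_greenKernel_mul hκ0 hκ hM0 hM' hg (r := r + d1) (by positivity) (z + d2)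
  have i2 := integrable_greenKernel_mul hκ0 hκ hM0 hM' hg hr z
  rw [Lminv_eq_integral_halfPlane i1, Lminv_eq_integral_halfPlane i2, ← mul_sub,
    ← integral_sub i1 i2, enorm_mul]
  have hpi : ‖1 / (2 * Real.pi)‖ₑ ≤ 1 := by
    rw [← ofReal_norm, ENNReal.ofReal_le_one, Real.norm_of_nonneg (by positivity),
      div_le_one (by positivity)]
    linarith [Real.pi_gt_three]
  have hmeas : Measurable (Function.uncurry fun (y : ℝ × ℝ) (u : ℝ) =>
      ENNReal.ofReal (domKernel κ (r + u * d1, z + u * d2) y) * ‖g y‖ₑ) := by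
    have h1 : Measurable fun v : (ℝ × ℝ) × ℝ =>
        Function.uncurry (domKernel κ) ((r + v.2 * d1, z + v.2 * d2), v.1) :=
      (measurable_domKernel κ).comp (by fun_prop)
    exact h1.ennreal_ofReal.mul (hg.measurable.comp measurable_fst).enorm
  calc _ ≤ 1 * ∫⁻ y, ‖greenKernel m (r + d1, z + d2) y * g y -
        greenKernel m (r, z) y * g y‖ₑ ∂halfPlane := by
        gcongr
        exact enorm_integral_le_lintegral_enorm _
    _ ≤ ∫⁻ y, ENNReal.ofReal (2 * M * (d1 + d2)) * (∫⁻ u in Icc (0:ℝ) 1,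
        ENNReal.ofReal (domKernel κ (r + u * d1, z + u * d2) y) * ‖g y‖ₑ) ∂halfPlane := by
        rw [one_mul]
        refine lintegral_mono_ae ?_
        filter_upwards [ae_halfPlane_pos, ae_halfPlane_ne r z] with y hy hyne
        rw [← sub_mul, enorm_mul, lintegral_mul_const' _ _ enorm_ne_top, ← mul_assoc]
        gcongr
        refine enorm_greenKernel_sub_le (t := y.1) (w := y.2) hr hy hd1 hd2 (fun u _ => ?_) hM hM0
        rcases hd with rfl | rfl
        · have := sq_pos_of_ne_zero (sub_ne_zero.2 hyne.1.symm)
          simp only [mul_zero, add_zero]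
          positivity
        · have := sq_pos_of_ne_zero (sub_ne_zero.2 hyne.2.symm)
          simp only [mul_zero, add_zero]
          positivity
    _ = _ := by
        rw [lintegral_const_mul' _ _ ENNReal.ofReal_ne_top,
          lintegral_lintegral_swap hmeas.aemeasurable]
        rfl

end

open Filter Topology in
lemma enorm_deriv_rpow_le_liminf {φ : ℝ → ℝ} {a p : ℝ} (hp : 0 < p) {h : ℕ → ℝ}
    (h0 : ∀ n, 0 < h n) (hlim : Tendsto h atTop (𝓝 0)) {A : ℕ → ℝ≥0∞}
    (hA : ∀ n, ‖φ (a + h n) - φ a‖ₑ ≤ ENNReal.ofReal (h n) * A n) :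
    ‖deriv φ a‖ₑ ^ p ≤ liminf (fun n => A n ^ p) atTop := by
  by_cases hd : DifferentiableAt ℝ φ a
  · have h1 := hasDerivAt_iff_tendsto_slope_zero.1 hd.hasDerivAt
    have h2 : Tendsto h atTop (𝓝[≠] 0) :=
      tendsto_nhdsWithin_iff.2 ⟨hlim, Eventually.of_forall fun n => (h0 n).ne'⟩
    have h3 := ((ENNReal.continuous_rpow_const (y := p)).tendsto _).comp ((h1.comp h2).enorm)
    rw [← h3.liminf_eq]
    refine liminf_le_liminf (Eventually.of_forall fun n => ?_)
    simp only [Function.comp_apply]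
    gcongr
    rw [smul_eq_mul, enorm_mul, enorm_inv (h0 n).ne', mul_comm, ← div_eq_mul_inv]
    refine ENNReal.div_le_of_le_mul' ?_
    rw [Real.enorm_of_nonneg (h0 n).le]
    exact hA n
  · rw [deriv_zero_of_not_differentiableAt hd, enorm_zero, ENNReal.zero_rpow_of_pos hp]
    exact zero_le

lemma lintegral_Icc_rpow_le {p : ℝ} (hp : 1 < p) {V : ℝ → ℝ≥0∞} (hV : Measurable V) :
    (∫⁻ u in Icc (0:ℝ) 1, V u) ^ p ≤ ∫⁻ u in Icc (0:ℝ) 1, V u ^ p := by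
  have hc := Real.HolderConjugate.conjExponent hp
  have h := ENNReal.lintegral_mul_le_Lp_mul_Lq (volume.restrict (Icc (0:ℝ) 1)) hc
    hV.aemeasurable (measurable_const (a := (1:ℝ≥0∞))).aemeasurable
  simp only [Pi.mul_apply, mul_one, ENNReal.one_rpow, lintegral_const, Measure.restrict_apply_univ,
    Real.volume_Icc, sub_zero, ENNReal.ofReal_one] at h
  refine (ENNReal.rpow_le_rpow h (by linarith)).trans_eq ?_
  rw [← ENNReal.rpow_mul, one_div, inv_mul_cancel₀ (by linarith), ENNReal.rpow_one]

lemma lintegral_weight_comp_le (e : ℝ) {V : ℝ × ℝ → ℝ≥0∞} (hV : Measurable V) {c : ℝ}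
    (hc1 : 1 ≤ c) (hc2 : c ≤ 2) (b : ℝ) :
    ∫⁻ x, ENNReal.ofReal (x.1 ^ e) * V (c * x.1, x.2 + b) ∂halfPlane ≤
      ENNReal.ofReal (2 ^ |e|) * ∫⁻ x, ENNReal.ofReal (x.1 ^ e) * V x ∂halfPlane := by
  have hc0 : 0 < c := by linarith
  have hW : Measurable fun x : ℝ × ℝ => ENNReal.ofReal (x.1 ^ e) := by fun_prop
  have hW1 : Measurable fun t : ℝ => ENNReal.ofReal (t ^ e) := by fun_prop
  have hVc : Measurable fun x : ℝ × ℝ => V (c * x.1, x.2 + b) := hV.comp (by fun_prop)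
  have hm1 : Measurable fun x : ℝ × ℝ => ENNReal.ofReal (x.1 ^ e) * V (c * x.1, x.2 + b) :=
    hW.mul hVc
  have hm2 : Measurable fun x : ℝ × ℝ => ENNReal.ofReal (x.1 ^ e) * V x := hW.mul hV
  have hm3 : Measurable fun t : ℝ => ENNReal.ofReal (t ^ e) * ∫⁻ w, V (t, w) :=
    hW1.mul hV.lintegral_prod_right'
  rw [lintegral_halfPlane hm1, lintegral_halfPlane hm2]
  simp only [lintegral_const_mul' _ _ ENNReal.ofReal_ne_top]
  have htr : ∀ t : ℝ, ∫⁻ w, V (t, w + b) = ∫⁻ w, V (t, w) := fun t =>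
    lintegral_add_right_eq_self (fun w => V (t, w)) b
  simp only [htr]
  calc _ = ∫⁻ r in Ioi 0, ENNReal.ofReal (c ^ (-e)) *
        (ENNReal.ofReal ((c * r) ^ e) * ∫⁻ w, V (c * r, w)) := by
        refine setLIntegral_congr_fun measurableSet_Ioi fun r hr => ?_
        have hr0 : 0 < r := hr
        rw [← mul_assoc, ← ENNReal.ofReal_mul (by positivity), mul_rpow hc0.le hr0.le,
          ← mul_assoc, ← rpow_add hc0, neg_add_cancel, rpow_zero, one_mul]
    _ = ENNReal.ofReal (c ^ (-e) * c⁻¹) *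
        ∫⁻ r in Ioi 0, ENNReal.ofReal (r ^ e) * ∫⁻ w, V (r, w) := by
        rw [lintegral_const_mul' _ _ ENNReal.ofReal_ne_top, lintegral_Ioi_comp_const_mul hc0 hm3,
          ← mul_assoc, ← ENNReal.ofReal_mul (by positivity)]
    _ ≤ _ := by
        gcongr
        calc c ^ (-e) * c⁻¹ ≤ c ^ |e| * 1 := by
              gcongr
              · exact neg_le_abs e
              · exact inv_le_one_of_one_le₀ hc1
          _ ≤ 2 ^ |e| := by rw [mul_one]; exact rpow_le_rpow hc0.le hc2 (abs_nonneg e)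

open Filter in
lemma lintegral_weight_enorm_le_of_liminf {e p : ℝ} (hp : 1 < p) {V : ℝ × ℝ → ℝ≥0∞}
    (hV : Measurable V) {S : ℝ≥0∞} (hS : S ≠ ∞) {δ1 δ2 : ℝ} (h0 : 0 ≤ δ1) (h1 : δ1 ≤ 1)
    {D : ℝ × ℝ → ℝ}
    (hD : ∀ x : ℝ × ℝ, 0 < x.1 → ‖D x‖ₑ ^ p ≤ liminf (fun n : ℕ => (S * ∫⁻ u in Icc (0:ℝ) 1,
      V ((1 + u * (δ1 / (n + 1))) * x.1, x.2 + u * (δ2 / (n + 1)))) ^ p) atTop) :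
    ∫⁻ r in Ioi 0, ∫⁻ z, ENNReal.ofReal (r ^ e) * ‖D (r, z)‖ₑ ^ p ≤
      ENNReal.ofReal (2 ^ |e|) * S ^ p *
        ∫⁻ x, ENNReal.ofReal (x.1 ^ e) * V x ^ p ∂halfPlane := by
  have hp0 : 0 < p := by linarith
  have hSp : S ^ p ≠ ∞ := ENNReal.rpow_ne_top_of_nonneg hp0.le hS
  have hVp : Measurable fun x => V x ^ p := hV.pow_const p
  have hW : Measurable fun x : ℝ × ℝ => ENNReal.ofReal (x.1 ^ e) := by fun_prop
  set J : ℕ → ℝ × ℝ → ℝ≥0∞ := fun n x => ∫⁻ u in Icc (0:ℝ) 1,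
      V ((1 + u * (δ1 / (n + 1))) * x.1, x.2 + u * (δ2 / (n + 1))) ^ p with hJ
  have hT : ∀ n : ℕ, Measurable fun v : (ℝ × ℝ) × ℝ =>
      V ((1 + v.2 * (δ1 / (n + 1))) * v.1.1, v.1.2 + v.2 * (δ2 / (n + 1))) := fun n =>
    hV.comp (by fun_prop)
  have hJm : ∀ n, Measurable (J n) := fun n => ((hT n).pow_const p).lintegral_prod_right'
  have hptwise : ∀ x : ℝ × ℝ, 0 < x.1 → ENNReal.ofReal (x.1 ^ e) * ‖D x‖ₑ ^ p ≤
      liminf (fun n => ENNReal.ofReal (x.1 ^ e) * (S ^ p * J n x)) atTop := by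
    intro x hx
    have hc : Continuous fun y : ℝ≥0∞ => ENNReal.ofReal (x.1 ^ e) * y :=
      ENNReal.continuous_const_mul ENNReal.ofReal_ne_top
    have hmono : Monotone fun y : ℝ≥0∞ => ENNReal.ofReal (x.1 ^ e) * y := fun a b hab => by
      simp only; gcongr
    have := hmono.map_liminf_of_continuousAt (F := atTop) (fun n => S ^ p * J n x) hc.continuousAt
    refine le_of_le_of_eq ?_ this
    refine mul_le_mul_right ((hD x hx).trans (liminf_le_liminf (Eventually.of_forall fun n => ?_))) _
    rw [ENNReal.mul_rpow_of_nonneg _ _ hp0.le]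
    exact mul_le_mul_right (lintegral_Icc_rpow_le hp ((hT n).comp measurable_prodMk_left)) _
  have hbound : ∀ n, ∫⁻ x, ENNReal.ofReal (x.1 ^ e) * (S ^ p * J n x) ∂halfPlane ≤
      ENNReal.ofReal (2 ^ |e|) * S ^ p *
        ∫⁻ x, ENNReal.ofReal (x.1 ^ e) * V x ^ p ∂halfPlane := by
    intro n
    have hsw : Measurable (Function.uncurry fun (x : ℝ × ℝ) (u : ℝ) => ENNReal.ofReal (x.1 ^ e) *
        V ((1 + u * (δ1 / (n + 1))) * x.1, x.2 + u * (δ2 / (n + 1))) ^ p) :=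
      (hW.comp measurable_fst).mul ((hT n).pow_const p)
    calc _ = S ^ p * ∫⁻ x, (∫⁻ u in Icc (0:ℝ) 1, ENNReal.ofReal (x.1 ^ e) *
          V ((1 + u * (δ1 / (n + 1))) * x.1, x.2 + u * (δ2 / (n + 1))) ^ p) ∂halfPlane := by
          rw [← lintegral_const_mul' _ _ hSp]
          refine lintegral_congr fun x => ?_
          rw [lintegral_const_mul' _ _ ENNReal.ofReal_ne_top, mul_left_comm]
      _ = S ^ p * ∫⁻ u in Icc (0:ℝ) 1, (∫⁻ x, ENNReal.ofReal (x.1 ^ e) *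
          V ((1 + u * (δ1 / (n + 1))) * x.1, x.2 + u * (δ2 / (n + 1))) ^ p ∂halfPlane) := by
          rw [lintegral_lintegral_swap hsw.aemeasurable]
      _ ≤ S ^ p * ∫⁻ u in Icc (0:ℝ) 1, ENNReal.ofReal (2 ^ |e|) *
          ∫⁻ x, ENNReal.ofReal (x.1 ^ e) * V x ^ p ∂halfPlane := by
          gcongr S ^ p * ?_
          refine setLIntegral_mono' measurableSet_Icc fun u hu => ?_
          have hn : δ1 / ((n:ℝ) + 1) ≤ 1 := by
            rw [div_le_one (by positivity)]
            have : (0:ℝ) ≤ n := n.cast_nonneg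
            linarith
          have hn0 : 0 ≤ δ1 / ((n:ℝ) + 1) := by positivity
          refine lintegral_weight_comp_le e hVp ?_ ?_ _
          · have := mul_nonneg hu.1 hn0; linarith
          · have := mul_le_one₀ hu.2 hn0 hn; linarith
      _ = _ := by
          rw [lintegral_const, Measure.restrict_apply_univ, Real.volume_Icc]
          simp only [sub_zero, ENNReal.ofReal_one, mul_one]
          ring
  have hterm : ∀ n, Measurable fun x => ENNReal.ofReal (x.1 ^ e) * (S ^ p * J n x) := fun n =>
    hW.mul ((hJm n).const_mul _)
  calc _ ≤ ∫⁻ x, liminf (fun n => ENNReal.ofReal (x.1 ^ e) * (S ^ p * J n x)) atTop ∂halfPlane := by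
        rw [lintegral_halfPlane (Measurable.liminf hterm)]
        refine setLIntegral_mono' measurableSet_Ioi fun r hr => lintegral_mono fun z => ?_
        exact hptwise (r, z) hr
    _ ≤ liminf (fun n => ∫⁻ x, ENNReal.ofReal (x.1 ^ e) * (S ^ p * J n x) ∂halfPlane) atTop :=
        lintegral_liminf_le hterm
    _ ≤ _ := liminf_le_of_le (by isBoundedDefault) fun b hb => by
        obtain ⟨n, hn⟩ := hb.exists
        exact hn.trans (hbound n)

section
variable {κ M p e : ℝ} {m : ℕ}

open Filter Topology in
lemma lintegral_weight_enorm_deriv_Lminv_le (hp : 1 < p) (hκ0 : 0 < κ) (hκ : κ < 1/2) (hM0 : 0 ≤ M)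
    (hM : ∀ s : ℝ, 0 < s → |Fm m s| ≤ M * decayProfile κ s ∧
      s * |deriv (Fm m) s| ≤ M * decayProfile κ s) {g : ℝ × ℝ → ℝ} (hg : BoxBounded g) :
    (∫⁻ r in Ioi 0, ∫⁻ z, ENNReal.ofReal (r ^ e) *
        ‖deriv (fun s => Lminv m (fun t w => g (t, w)) s z) r‖ₑ ^ p ≤
      ENNReal.ofReal (2 ^ |e|) * ENNReal.ofReal (2 * M) ^ p *
        ∫⁻ x, ENNReal.ofReal (x.1 ^ e) * domPotential κ (fun y => ‖g y‖ₑ) x ^ p ∂halfPlane) ∧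
    (∫⁻ r in Ioi 0, ∫⁻ z, ENNReal.ofReal (r ^ e) *
        ‖deriv (fun s => Lminv m (fun t w => g (t, w)) r s) z‖ₑ ^ p ≤
      ENNReal.ofReal (2 ^ |e|) * ENNReal.ofReal (2 * M) ^ p *
        ∫⁻ x, ENNReal.ofReal (x.1 ^ e) * domPotential κ (fun y => ‖g y‖ₑ) x ^ p ∂halfPlane) := by
  have hV := measurable_domPotential κ hg.measurable.enorm
  have hlim : ∀ c : ℝ, Tendsto (fun n : ℕ => c * (1 / ((n:ℝ) + 1))) atTop (𝓝 0) := fun c => by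
    simpa using tendsto_one_div_add_atTop_nhds_zero_nat.const_mul c
  constructor
  · refine lintegral_weight_enorm_le_of_liminf hp hV ENNReal.ofReal_ne_top (δ1 := 1) (δ2 := 0)
      (D := fun x => deriv (fun s => Lminv m (fun t w => g (t, w)) s x.2) x.1) zero_le_one le_rfl fun x hx => ?_
    refine enorm_deriv_rpow_le_liminf (by linarith) (h := fun n => x.1 * (1 / ((n:ℝ) + 1)))
      (fun n => by positivity) (hlim _) fun n => ?_
    have h := enorm_Lminv_sub_le hκ0 hκ hM0 hM hg hx x.2 (d1 := x.1 * (1 / ((n:ℝ) + 1))) (d2 := 0)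
      (by positivity) le_rfl (Or.inr rfl)
    simp only [add_zero, mul_zero, zero_div] at h ⊢
    refine h.trans_eq ?_
    conv_rhs => rw [← mul_assoc, ← ENNReal.ofReal_mul (by positivity), mul_comm _ (2 * M)]
    congr 2
    ext u
    congr 2
    ring
  · refine lintegral_weight_enorm_le_of_liminf hp hV ENNReal.ofReal_ne_top (δ1 := 0) (δ2 := 1)
      (D := fun x => deriv (fun s => Lminv m (fun t w => g (t, w)) x.1 s) x.2) le_rfl zero_le_one fun x hx => ?_
    refine enorm_deriv_rpow_le_liminf (by linarith) (h := fun n => 1 * (1 / ((n:ℝ) + 1)))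
      (fun n => by positivity) (hlim _) fun n => ?_
    have h := enorm_Lminv_sub_le hκ0 hκ hM0 hM hg hx x.2 (d1 := 0) (d2 := 1 / ((n:ℝ) + 1))
      le_rfl (by positivity) (Or.inl rfl)
    simp only [add_zero, zero_add, mul_zero, zero_div, one_mul] at h ⊢
    refine h.trans_eq ?_
    conv_rhs => rw [← mul_assoc, ← ENNReal.ofReal_mul (by positivity), mul_comm _ (2 * M)]

end

lemma ofReal_integral_weight_le {p α : ℝ} (hp : 0 < p) (D : ℝ → ℝ → ℝ) :
    ENNReal.ofReal (∫ r in Ioi (0:ℝ), ∫ z : ℝ, |r ^ α * D r z| ^ p * r) ≤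
      ∫⁻ r in Ioi 0, ∫⁻ z, ENNReal.ofReal (r ^ (α * p + 1)) * ‖D r z‖ₑ ^ p := by
  refine (Real.ofReal_le_enorm _).trans ((enorm_integral_le_lintegral_enorm _).trans ?_)
  refine setLIntegral_mono' measurableSet_Ioi fun r hr => ?_
  have hr0 : 0 < r := hr
  refine (enorm_integral_le_lintegral_enorm _).trans (lintegral_mono fun z => ?_)
  rw [← ofReal_norm, ← ofReal_norm (D r z), ENNReal.ofReal_rpow_of_nonneg (norm_nonneg _) hp.le,
    ← ENNReal.ofReal_mul (by positivity), Real.norm_of_nonneg (by positivity), abs_mul,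
    mul_rpow (abs_nonneg _) (abs_nonneg _), abs_of_pos (by positivity : 0 < r ^ α),
    ← rpow_mul hr0.le, rpow_add_one hr0.ne', Real.norm_eq_abs]
  exact (congrArg ENNReal.ofReal (by ring)).le

lemma TestFun.lintegral_weight_eq {f : ℝ → ℝ → ℝ} (hf : TestFun f) {q β : ℝ} (hq : 0 < q) :
    ∫⁻ y, ENNReal.ofReal (y.1 ^ ((1 - β) * q + 1)) * ‖y.1 ^ (β - 1) * f y.1 y.2‖ₑ ^ q ∂halfPlane =
      ENNReal.ofReal (∫ r in Ioi (0:ℝ), ∫ z : ℝ, |f r z| ^ q * r) := by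
  have hfc : Continuous fun y : ℝ × ℝ => f y.1 y.2 := hf.1.continuous
  have hcont : Continuous fun y : ℝ × ℝ => |f y.1 y.2| ^ q * y.1 :=
    (hfc.abs.rpow_const fun _ => Or.inr hq.le).mul continuous_fst
  have hcs : HasCompactSupport fun y : ℝ × ℝ => |f y.1 y.2| ^ q * y.1 := by
    refine hf.2.1.mono fun y hy => ?_
    contrapose! hy
    have h0 : f y.1 y.2 = 0 := by simpa [Function.uncurry] using hy
    simp [h0, zero_rpow hq.ne']
  have hinteg : Integrable (fun y : ℝ × ℝ => |f y.1 y.2| ^ q * y.1) halfPlane := by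
    rw [halfPlane_eq_restrict]
    exact (hcont.integrable_of_hasCompactSupport hcs).restrict
  have hfub : ∫ y, |f y.1 y.2| ^ q * y.1 ∂halfPlane =
      ∫ r in Ioi (0:ℝ), ∫ z : ℝ, |f r z| ^ q * r := integral_prod _ hinteg
  rw [← hfub, ofReal_integral_eq_lintegral_ofReal hinteg]
  · refine lintegral_congr_ae ?_
    filter_upwards [ae_halfPlane_pos] with y hy
    rw [← ofReal_norm, ENNReal.ofReal_rpow_of_nonneg (norm_nonneg _) hq.le,
      ← ENNReal.ofReal_mul (by positivity), Real.norm_eq_abs, abs_mul,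
      mul_rpow (abs_nonneg _) (abs_nonneg _), abs_of_pos (by positivity : 0 < y.1 ^ (β - 1)),
      ← rpow_mul hy.le, ← mul_assoc, ← rpow_add hy,
      show (1 - β) * q + 1 + (β - 1) * q = 1 by ring, rpow_one, mul_comm]
  · filter_upwards [ae_halfPlane_pos] with y hy
    simp only [Pi.zero_apply]
    positivity

/-- Proposition 2.6 (lemLmp): weighted bounds for `∇̃ L_m^{-1}`. -/
theorem grad_Lminv_weighted_bounds (p q α β : ℝ)
    (hq1 : 1 < q) (hqp : q < p)
    (hαβ : 0 < α + β) (hα : -2 ≤ α + 1/p) (hβ : -3 ≤ β - 1/q)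
    (hscal : 1/q = 1/p + (α + β)/3) (hhalf : 0 < 1/2 + 1/p - 1/q) :
    ∃ ε₀ : ℝ, 0 < ε₀ ∧ ∀ ε : ℝ, 0 < ε → ε < ε₀ →
      ∃ C : ℝ, 0 < C ∧ ∀ m : ℕ, 3 ≤ m → ∀ f : ℝ → ℝ → ℝ, TestFun f →
        (cylLp p (fun r z => r ^ α *
            deriv (fun s => Lminv m (fun r' z' => r' ^ (β - 1) * f r' z') s z) r)
            ≤ C * (m : ℝ) ^ (-(1/2 + 1/p - 1/q - ε)) * cylLp q f) ∧
        (cylLp p (fun r z => r ^ α *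
            deriv (fun s => Lminv m (fun r' z' => r' ^ (β - 1) * f r' z') r s) z)
            ≤ C * (m : ℝ) ^ (-(1/2 + 1/p - 1/q - ε)) * cylLp q f) := by
  refine ⟨1/2 + 1/p - 1/q, hhalf, fun ε hε hε' => ?_⟩
  have hq0 : 0 < q := by linarith
  have hp0 : 0 < p := by linarith
  have hpq : 1/p < 1/q := one_div_lt_one_div_of_lt hq0 hqp
  set κ : ℝ := 1/2 + 1/p - 1/q - ε with hκdef
  have hκ0 : 0 < κ := by linarith
  have hκ : κ < 1/2 := by linarith
  obtain ⟨C0, hC0, hF⟩ := exists_Fm_bound hκ0 hκ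
  obtain ⟨T, hT, hpot⟩ := exists_lintegral_domPotential_le hq1 hqp hα hβ hscal hκ0
    (by linarith : κ < 1/2 + 1/p - 1/q)
  set e : ℝ := α * p + 1 with he
  set A : ℝ := 2 * Real.pi * 2 ^ |e| * (T.toReal + 1) with hA
  have hT0 : 0 ≤ T.toReal := ENNReal.toReal_nonneg
  have hpi := Real.pi_pos
  have hA0 : 0 < A := by positivity
  refine ⟨A ^ (1/p) * (2 * C0), by positivity, fun m hm f hf => ?_⟩
  have hm0 : (0:ℝ) < m := by exact_mod_cast (by omega : 0 < m)
  set M : ℝ := C0 * (m:ℝ) ^ (-κ) with hMdef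
  have hM0 : 0 ≤ M := by positivity
  have hg := hf.boxBounded (β - 1)
  set J : ℝ := ∫ r in Ioi (0:ℝ), ∫ z : ℝ, |f r z| ^ q * r with hJ
  have hJ0 : 0 ≤ J := setIntegral_nonneg measurableSet_Ioi fun r hr => integral_nonneg fun z =>
    mul_nonneg (by positivity) (le_of_lt hr)
  have hpotf := hpot _ hg.measurable.enorm
  rw [hf.lintegral_weight_eq hq0, ← hJ] at hpotf
  have key : ∀ D : ℝ → ℝ → ℝ,
      ∫⁻ r in Ioi 0, ∫⁻ z, ENNReal.ofReal (r ^ e) * ‖D r z‖ₑ ^ p ≤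
        ENNReal.ofReal (2 ^ |e|) * ENNReal.ofReal (2 * M) ^ p *
          ∫⁻ x, ENNReal.ofReal (x.1 ^ e) *
            domPotential κ (fun y => ‖y.1 ^ (β - 1) * f y.1 y.2‖ₑ) x ^ p ∂halfPlane →
      cylLp p (fun r z => r ^ α * D r z) ≤
        A ^ (1/p) * (2 * C0) * (m:ℝ) ^ (-κ) * cylLp q f := by
    intro D hD
    have h1 := (ofReal_integral_weight_le hp0 D).trans (hD.trans (mul_le_mul_right hpotf _))
    set I : ℝ := ∫ r in Ioi (0:ℝ), ∫ z : ℝ, |r ^ α * D r z| ^ p * r with hI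
    have hI0 : 0 ≤ I := setIntegral_nonneg measurableSet_Ioi fun r hr => integral_nonneg fun z =>
      mul_nonneg (by positivity) (le_of_lt hr)
    have h2 : I ≤ 2 ^ |e| * (2 * M) ^ p * (T.toReal * J ^ (p / q)) := by
      rw [← ENNReal.ofReal_toReal hT, ENNReal.ofReal_rpow_of_nonneg (by positivity) hp0.le,
        ENNReal.ofReal_rpow_of_nonneg hJ0 (by positivity), ← ENNReal.ofReal_mul (by positivity),
        ← ENNReal.ofReal_mul (by positivity), ← ENNReal.ofReal_mul (by positivity)] at h1
      exact (ENNReal.ofReal_le_ofReal_iff (by positivity)).1 h1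
    have h3 : 2 * Real.pi * I ≤ A * (2 * M) ^ p * J ^ (p / q) := by
      calc 2 * Real.pi * I ≤ 2 * Real.pi * (2 ^ |e| * (2 * M) ^ p *
            ((T.toReal + 1) * J ^ (p / q))) := by
            gcongr
            refine h2.trans ?_
            gcongr
            linarith
        _ = _ := by rw [hA]; ring
    calc cylLp p (fun r z => r ^ α * D r z) = (2 * Real.pi * I) ^ (1/p) := rfl
      _ ≤ (A * (2 * M) ^ p * J ^ (p / q)) ^ (1/p) := by gcongr
      _ = A ^ (1/p) * (2 * M) * J ^ (1/q) := by
          rw [mul_rpow (by positivity) (by positivity), mul_rpow (by positivity) (by positivity),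
            ← rpow_mul (by positivity), ← rpow_mul hJ0, mul_one_div_cancel hp0.ne', rpow_one]
          congr 2
          field_simp
      _ ≤ A ^ (1/p) * (2 * M) * (2 * Real.pi * J) ^ (1/q) := by
          gcongr
          nlinarith [Real.pi_gt_three]
      _ = A ^ (1/p) * (2 * C0) * (m:ℝ) ^ (-κ) * cylLp q f := by
          rw [hMdef, cylLp, ← hJ]; ring
  obtain ⟨hr, hz⟩ := lintegral_weight_enorm_deriv_Lminv_le (e := e) (hq1.trans hqp) hκ0 hκ hM0
    (hF m hm) hg
  exact ⟨key _ hr, key _ hz⟩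

end
end
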